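/- Assume U and g are real-analytic, and let (q, p) : [0,T] → ℝ^m × ℝ^m solve the constrained system (q̇ = M⁻¹p, ṗ = −∇U(q) − ∇g(q)·λ(q,p), g(q(t)) = 0) with consistent initial data (g(q(0)) = 0, ∇g(q(0))ᵀM⁻¹p(0) = 0) and with ∇g(q(t))ᵀM⁻¹∇g(q(t)) nonsingular for all t ∈ [0,T]. Then there exist h₀ > 0 and C > 0 such that for every N ∈ ℕ with h := T/N ≤ h₀ there exist vectors q_0 = q(0), p_0 = p(0), (q_n, p_n)_{n=1,…,N} in ℝ^m, multipliers (λ_n)_{n=0,…,N−1} in ℝ^ν, and C¹ functions (u_n, v_n) : [0,h] → ℝ^m × ℝ^m such that for every n: u_n(0) = q_n, v_n(0) = p_n, u̇_n = M⁻¹v_n, v̇_n = −∇U(u_n) − ∇g(u_n)λ_n on [0,h], q_{n+1} = u_n(h), p_{n+1} = v_n(h), and the approximations satisfy g(q_n) = 0, H(q_n, p_n) = H(q_0, p_0), ‖q_n − q(nh)‖ ≤ C·h², ‖p_n − p(nh)‖ ≤ C·h², ‖∇g(q_n)ᵀM⁻¹p_n‖ ≤ C·h², and ‖λ_n − λ(q(nh),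 p(nh))‖ ≤ C·h. -/

import Mathlib

open MeasureTheory Matrix Set

noncomputable def grad {m : ℕ} (f : (Fin m → ℝ) → ℝ) (q : Fin m → ℝ) : Fin m → ℝ :=
  fun i => fderiv ℝ f q (Pi.single i 1)

noncomputable def gradMat {m ν : ℕ} (g : (Fin m → ℝ) → (Fin ν → ℝ)) (q : Fin m → ℝ) :
    Matrix (Fin m) (Fin ν) ℝ :=
  Matrix.of fun i a => fderiv ℝ (fun x => g x a) q (Pi.single i 1)

noncomputable def hessVec {m ν : ℕ} (g : (Fin m → ℝ) → (Fin ν → ℝ)) (q v w : Fin m → ℝ) :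
    Fin ν → ℝ :=
  fun a => fderiv ℝ (fun x => fderiv ℝ (fun y => g y a) x w) q v

noncomputable def lagMult {m ν : ℕ} (M : Matrix (Fin m) (Fin m) ℝ)
    (U : (Fin m → ℝ) → ℝ) (g : (Fin m → ℝ) → (Fin ν → ℝ)) (q p : Fin m → ℝ) : Fin ν → ℝ :=
  ((gradMat g q)ᵀ * M⁻¹ * gradMat g q)⁻¹ *ᵥ
    (hessVec g q (M⁻¹ *ᵥ p) (M⁻¹ *ᵥ p) - (gradMat g q)ᵀ *ᵥ (M⁻¹ *ᵥ grad U q))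

noncomputable def Ham {m : ℕ} (M : Matrix (Fin m) (Fin m) ℝ)
    (U : (Fin m → ℝ) → ℝ) (q p : Fin m → ℝ) : ℝ :=
  (1 / 2) * (p ⬝ᵥ (M⁻¹ *ᵥ p)) + U q

noncomputable def HamHat {m ν : ℕ} (M : Matrix (Fin m) (Fin m) ℝ)
    (U : (Fin m → ℝ) → ℝ) (g : (Fin m → ℝ) → (Fin ν → ℝ))
    (q p : Fin m → ℝ) (lam : Fin ν → ℝ) : ℝ :=
  Ham M U q p + lam ⬝ᵥ g q

noncomputable def shiftedLegendre (j : ℕ) (x : ℝ) : ℝ :=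
  (Real.sqrt (2 * j + 1) / (Nat.factorial j)) * iteratedDeriv j (fun y => (y ^ 2 - y) ^ j) x


section abstractPart

variable {X F : Type*} [NormedAddCommGroup X] [NormedSpace ℝ X]
  [NormedAddCommGroup F] [NormedSpace ℝ F]

/-- Uniform boundedness and Lipschitz continuity on a compact set. -/
theorem lipK {Ω K : Set X} (hΩ : IsOpen Ω) (hK : IsCompact K) (hKΩ : K ⊆ Ω) {φ : X → F}
    (hφ : ContDiffOn ℝ 1 φ Ω) :
    ∀ᶠ L : ℝ in Filter.atTop, (∀ x ∈ K, ‖φ x‖ ≤ L) ∧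
      ∀ x ∈ K, ∀ y ∈ K, ‖φ x - φ y‖ ≤ L * ‖x - y‖ := by
  have h1 : LocallyLipschitzOn K φ := by
    intro x hx
    obtain ⟨C, t, ht, hL⟩ := (hφ.contDiffAt (hΩ.mem_nhds (hKΩ hx))).exists_lipschitzOnWith
    exact ⟨C, t, mem_nhdsWithin_of_mem_nhds ht, hL⟩
  obtain ⟨C, hC⟩ := h1.exists_lipschitzOnWith_of_compact hK
  obtain ⟨D, hD⟩ := hK.exists_bound_of_continuousOn (hφ.continuousOn.mono hKΩ)
  filter_upwards [Filter.eventually_ge_atTop (C : ℝ), Filter.eventually_ge_atTop D] with L h1 h2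
  refine ⟨fun x hx => (hD x hx).trans h2, fun x hx y hy => ?_⟩
  exact (hC.norm_sub_le hx hy).trans (by gcongr)

/-- Mean value bound. -/
theorem mvt0 {D D' : ℝ → F} {h ε : ℝ} 
    (hD : ∀ t ∈ Icc (0:ℝ) h, HasDerivAt D (D' t) t) (hb : ∀ t ∈ Icc (0:ℝ) h, ‖D' t‖ ≤ ε) :
    ∀ t ∈ Icc (0:ℝ) h, ‖D t - D 0‖ ≤ ε * t := by
  intro t ht
  have := norm_image_sub_le_of_norm_deriv_le_segment' (f := D) (f' := D') (a := 0) (b := h)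
    (fun x hx => (hD x hx).hasDerivWithinAt) (fun x hx => hb x ⟨hx.1, hx.2.le⟩) t ht
  simpa using this

/-- Iterated mean value bound. -/
theorem mvt2 {D D' D'' : ℝ → F} {h ε : ℝ} (hε : 0 ≤ ε)
    (hD : ∀ t ∈ Icc (0:ℝ) h, HasDerivAt D (D' t) t)
    (hD' : ∀ t ∈ Icc (0:ℝ) h, HasDerivAt D' (D'' t) t)
    (h0 : D 0 = 0) (h0' : D' 0 = 0)
    (hb : ∀ t ∈ Icc (0:ℝ) h, ‖D'' t‖ ≤ ε) :
    ∀ t ∈ Icc (0:ℝ) h, ‖D t‖ ≤ ε * h ^ 2 ∧ ‖D' t‖ ≤ ε * h := by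
  have h1 : ∀ t ∈ Icc (0:ℝ) h, ‖D' t‖ ≤ ε * h := by
    intro t ht
    have := mvt0 hD' hb t ht
    rw [h0', sub_zero] at this
    exact this.trans (by gcongr; exact ht.2)
  intro t ht
  refine ⟨?_, h1 t ht⟩
  have := mvt0 hD h1 t ht
  rw [h0, sub_zero] at this
  have hh : 0 ≤ h := ht.1.trans ht.2
  refine this.trans ?_
  rw [pow_two, ← mul_assoc]
  gcongr; exact ht.2

theorem grw {D D' : ℝ → F} {h L ε δ : ℝ} (hL : 0 < L)
    (hD : ∀ t ∈ Icc (0:ℝ) h, HasDerivAt D (D' t) t) (h0 : ‖D 0‖ ≤ δ)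
    (hb : ∀ t ∈ Icc (0:ℝ) h, ‖D' t‖ ≤ L * ‖D t‖ + ε) :
    ∀ t ∈ Icc (0:ℝ) h, ‖D t‖ ≤ δ * Real.exp (L * t) + ε / L * (Real.exp (L * t) - 1) := by
  intro t ht
  have := norm_le_gronwallBound_of_norm_deriv_right_le (f := D) (f' := D') (a := 0) (b := h)
    (δ := δ) (K := L) (ε := ε)
    (fun x hx => (hD x hx).continuousAt.continuousWithinAt)
    (fun x hx => (hD x ⟨hx.1, hx.2.le⟩).hasDerivWithinAt) h0
    (fun x hx => hb x ⟨hx.1, hx.2.le⟩) t ht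
  rw [gronwallBound_of_K_ne_0 hL.ne'] at this
  simpa using this

theorem picard_local [CompleteSpace X] {f : X → X} {x₀ : X} {ρ L : ℝ} (hρ : 0 < ρ) (hL : 0 < L)
    (hb : ∀ x ∈ Metric.closedBall x₀ ρ, ‖f x‖ ≤ L)
    (hl : ∀ x ∈ Metric.closedBall x₀ ρ, ∀ y ∈ Metric.closedBall x₀ ρ,
      ‖f x - f y‖ ≤ L * ‖x - y‖) :
    ∃ x : ℝ → X, x 0 = x₀ ∧ ∀ t ∈ Icc (0:ℝ) (ρ / (2 * L)), HasDerivAt x (f (x t)) t ∧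
      x t ∈ Metric.closedBall x₀ ρ := by
  have hτ : 0 < ρ / L := by positivity
  let t₀ : Icc (-(ρ / L)) (ρ / L) := ⟨0, by constructor <;> linarith⟩
  have hf : IsPicardLindelof (fun _ : ℝ => f) t₀ x₀ (NNReal.mk ρ hρ.le) 0 (NNReal.mk L hL.le) (NNReal.mk L hL.le) := by
    refine ⟨fun t _ => ?_, fun x _ => continuousOn_const, fun t _ x hx => hb x hx, ?_⟩
    · exact LipschitzOnWith.of_dist_le_mul fun x hx y hy => by
        rw [dist_eq_norm, dist_eq_norm]; exact hl x hx y hy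
    · simp [t₀]
      field_simp
      exact le_rfl
  obtain ⟨α, hα⟩ := ODE.FunSpace.exists_isFixedPt_next hf
    (Metric.mem_closedBall_self le_rfl : x₀ ∈ Metric.closedBall x₀ ((0 : NNReal) : ℝ))
  have hmem : ∀ t, α.compProj t ∈ Metric.closedBall x₀ ρ := fun t =>
    α.compProj_mem_closedBall hf.mul_max_le
  have hder : ∀ t ∈ Icc (-(ρ / L)) (ρ / L),
      HasDerivWithinAt α.compProj (f (α.compProj t)) (Icc (-(ρ / L)) (ρ / L)) t := by
    intro t ht
    apply ODE.hasDerivWithinAt_picard_Icc t₀.2 hf.continuousOn_uncurry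
      α.continuous_compProj.continuousOn (fun _ ht' ↦ α.compProj_mem_closedBall hf.mul_max_le)
      x₀ ht |>.congr_of_mem _ ht
    intro t' ht'
    nth_rw 1 [← hα]
    rw [ODE.FunSpace.compProj_of_mem ht', ODE.FunSpace.next_apply]
  refine ⟨α.compProj, ?_, fun t ht => ⟨?_, hmem t⟩⟩
  · change α.compProj (t₀ : ℝ) = x₀
    rw [ODE.FunSpace.compProj_val, ← hα, ODE.FunSpace.next_apply₀]
  · have h2 : ρ / (2 * L) < ρ / L := by
      rw [mul_comm, ← div_div]; linarith
    have h1 : Icc (-(ρ / L)) (ρ / L) ∈ nhds t := Icc_mem_nhds (by linarith [ht.1]) (by linarith [ht.2])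
    exact (hder t (mem_of_mem_nhds h1)).hasDerivAt h1

/-- The quantitative data used for one step of the method. -/
structure Bd (f : X × F → X) (g w : X → F) (B Bi : X → F →L[ℝ] F) (μ : X → F)
    (Γ : X × F → F) (K' K : Set X) (L R ρ : ℝ) : Prop where
  L1 : 1 ≤ L
  R1 : 1 ≤ R
  RL : R ≤ L
  ρ0 : 0 < ρ
  KK : ∀ x ∈ K', Metric.closedBall x ρ ⊆ K
  fB : ∀ x ∈ K, ∀ l : F, ‖l‖ ≤ R → ‖f (x, l)‖ ≤ L
  fL : ∀ x ∈ K, ∀ l : F, ‖l‖ ≤ R → ∀ y ∈ K, ∀ l' : F, ‖l'‖ ≤ R →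
    ‖f (x, l) - f (y, l')‖ ≤ L * (‖x - y‖ + ‖l - l'‖)
  gD : ∀ x ∈ K, ∀ l : F, ∃ g' : X →L[ℝ] F, HasFDerivAt g g' x ∧ g' (f (x, l)) = w x
  wD : ∀ x ∈ K, ∀ l : F, ∃ w' : X →L[ℝ] F, HasFDerivAt w w' x ∧
    w' (f (x, l)) = B x (μ x - l)
  bD : ∀ x ∈ K, ∀ l : F, ∃ b' : X →L[ℝ] F, HasFDerivAt (fun y => B y (μ y - l)) b' x ∧
    b' (f (x, l)) = Γ (x, l)
  BB : ∀ x ∈ K, ‖B x‖ ≤ L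
  BiB : ∀ x ∈ K, ‖Bi x‖ ≤ L
  BBi : ∀ x ∈ K, ∀ η, B x (Bi x η) = η
  BiBe : ∀ x ∈ K, ∀ η, Bi x (B x η) = η
  BL : ∀ x ∈ K, ∀ y ∈ K, ‖B x - B y‖ ≤ L * ‖x - y‖
  cL : ∀ x ∈ K, ∀ y ∈ K, ‖B x (μ x) - B y (μ y)‖ ≤ L * ‖x - y‖
  μL : ∀ x ∈ K, ∀ y ∈ K, ‖μ x - μ y‖ ≤ L * ‖x - y‖
  μB : ∀ x ∈ K, ‖μ x‖ ≤ R - 1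
  ΓB : ∀ x ∈ K, ∀ l : F, ‖l‖ ≤ R → ‖Γ (x, l)‖ ≤ L
  ΓL : ∀ x ∈ K, ∀ l : F, ‖l‖ ≤ R → ∀ y ∈ K, ∀ l' : F, ‖l'‖ ≤ R →
    ‖Γ (x, l) - Γ (y, l')‖ ≤ L * (‖x - y‖ + ‖l - l'‖)

variable {f : X × F → X} {g w : X → F} {B Bi : X → F →L[ℝ] F} {μ : X → F}
    {Γ : X × F → F} {K' K : Set X} {L R ρ : ℝ}

theorem Bd.flow [CompleteSpace X] (H : Bd f g w B Bi μ Γ K' K L R ρ) (x₀ : X) (hx₀ : x₀ ∈ K')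
    (l : F) (hl : ‖l‖ ≤ R) :
    ∃ x : ℝ → X, x 0 = x₀ ∧ ∀ t ∈ Icc (0:ℝ) (ρ / (2 * L)), HasDerivAt x (f (x t, l)) t ∧
      x t ∈ K ∧ ‖x t - x₀‖ ≤ L * t := by
  have hL := zero_lt_one.trans_le H.L1
  obtain ⟨x, hx0, hx⟩ := picard_local (f := fun y => f (y, l)) (x₀ := x₀) H.ρ0 hL
    (fun x hx => H.fB x (H.KK x₀ hx₀ hx) l hl)
    (fun x hx y hy => by
      simpa using H.fL x (H.KK x₀ hx₀ hx) l hl y (H.KK x₀ hx₀ hy) l hl)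
  refine ⟨x, hx0, fun t ht => ⟨(hx t ht).1, H.KK x₀ hx₀ (hx t ht).2, ?_⟩⟩
  have := mvt0 (fun t ht => (hx t ht).1)
    (fun t ht => H.fB _ (H.KK x₀ hx₀ (hx t ht).2) l hl) t ht
  rwa [hx0] at this

/-- derivatives along solutions -/
theorem Bd.along (H : Bd f g w B Bi μ Γ K' K L R ρ) {x : ℝ → X} {l : F} {t : ℝ}
    (hx : HasDerivAt x (f (x t, l)) t) (hK : x t ∈ K) :
    HasDerivAt (fun s => g (x s)) (w (x t)) t ∧
    HasDerivAt (fun s => w (x s)) (B (x t) (μ (x t) - l)) t ∧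
    HasDerivAt (fun s => B (x s) (μ (x s) - l)) (Γ (x t, l)) t := by
  obtain ⟨g', h1, h2⟩ := H.gD _ hK l
  obtain ⟨w', h3, h4⟩ := H.wD _ hK l
  obtain ⟨b', h5, h6⟩ := H.bD _ hK l
  refine ⟨?_, ?_, ?_⟩
  · rw [← h2]; exact h1.comp_hasDerivAt t hx
  · rw [← h4]; exact h3.comp_hasDerivAt t hx
  · rw [← h6]; exact h5.comp_hasDerivAt t hx

/-- Lipschitz dependence on the multiplier -/
theorem Bd.lipFlow (H : Bd f g w B Bi μ Γ K' K L R ρ) {x y : ℝ → X} {l l' : F} {h : ℝ}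
    (hl : ‖l‖ ≤ R) (hl' : ‖l'‖ ≤ R) (hh : L * h ≤ 1) (h0 : x 0 = y 0)
    (hx : ∀ t ∈ Icc (0:ℝ) h, HasDerivAt x (f (x t, l)) t ∧ x t ∈ K)
    (hy : ∀ t ∈ Icc (0:ℝ) h, HasDerivAt y (f (y t, l')) t ∧ y t ∈ K) :
    ∀ t ∈ Icc (0:ℝ) h, ‖x t - y t‖ ≤ 2 * L * h * ‖l - l'‖ := by
  intro t ht
  have hL := zero_lt_one.trans_le H.L1
  have := grw (D := fun t => x t - y t) (δ := 0) (ε := L * ‖l - l'‖) hL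
    (fun t ht => (hx t ht).1.sub (hy t ht).1) (by simp [h0])
    (fun t ht => by
      have := H.fL _ (hx t ht).2 l hl _ (hy t ht).2 l' hl'
      rw [mul_add] at this; exact this) t ht
  have e1 : L * t ≤ L * h := by gcongr; exact ht.2
  have e2 : |L * t| = L * t := abs_of_nonneg (mul_nonneg hL.le ht.1)
  have e3 := Real.abs_exp_sub_one_le (x := L * t) (by rw [e2]; linarith)
  rw [e2] at e3
  have e4 := (le_abs_self _).trans e3
  simp only [zero_mul, zero_add] at this
  rw [mul_div_cancel_left₀ _ hL.ne'] at this
  refine this.trans ?_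
  rw [mul_comm]
  gcongr
  linarith

end abstractPart

section abstractPart2

variable {X F : Type*} [NormedAddCommGroup X] [NormedSpace ℝ X]
  [NormedAddCommGroup F] [NormedSpace ℝ F]

theorem contr [CompleteSpace F] {Ψ : F → F} {c : F} {r : ℝ} (hr : 0 ≤ r)
    (hΨ : ∀ l ∈ Metric.closedBall c r, ∀ l' ∈ Metric.closedBall c r,
      ‖Ψ l - Ψ l'‖ ≤ (1 / 2) * ‖l - l'‖)
    (h0 : ‖Ψ c - c‖ ≤ r / 2) : ∃ l ∈ Metric.closedBall c r, Ψ l = l := by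
  have hc : c ∈ Metric.closedBall c r := Metric.mem_closedBall_self hr
  have hm : MapsTo Ψ (Metric.closedBall c r) (Metric.closedBall c r) := by
    intro l hl
    have h1 := hΨ l hl c hc
    have h2 : ‖l - c‖ ≤ r := by rwa [← dist_eq_norm]
    rw [Metric.mem_closedBall, dist_eq_norm]
    calc ‖Ψ l - c‖ = ‖(Ψ l - Ψ c) + (Ψ c - c)‖ := by congr 1; abel
      _ ≤ ‖Ψ l - Ψ c‖ + ‖Ψ c - c‖ := norm_add_le _ _
      _ ≤ r := by linarith
  have hk : ContractingWith (1 / 2 : NNReal) (hm.restrict Ψ _ _) := by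
    refine ⟨by rw [← NNReal.coe_lt_coe]; norm_num, LipschitzWith.of_dist_le_mul fun x y => ?_⟩
    have := hΨ x x.2 y y.2
    rw [Subtype.dist_eq, Subtype.dist_eq, dist_eq_norm, dist_eq_norm]
    simpa using this
  obtain ⟨y, hy, hfy, -⟩ := hk.exists_fixedPoint' Metric.isClosed_closedBall.isComplete hm hc
    (edist_ne_top _ _)
  exact ⟨y, hy, hfy⟩

variable {f : X × F → X} {g w : X → F} {B Bi : X → F →L[ℝ] F} {μ : X → F}
    {Γ : X × F → F} {K' K : Set X} {L R ρ : ℝ}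

/-- Dependence of the constraint defect on the multiplier. -/
theorem Bd.gdiff (H : Bd f g w B Bi μ Γ K' K L R ρ) {x y : ℝ → X} {l l' : F} {h : ℝ}
    (hl : ‖l‖ ≤ R) (hl' : ‖l'‖ ≤ R) (hpos : 0 ≤ h) (hh : L * h ≤ 1) (h0 : x 0 = y 0)
    (hx0 : x 0 ∈ K)
    (hx : ∀ t ∈ Icc (0:ℝ) h, HasDerivAt x (f (x t, l)) t ∧ x t ∈ K ∧ ‖x t - x 0‖ ≤ L * t)
    (hy : ∀ t ∈ Icc (0:ℝ) h, HasDerivAt y (f (y t, l')) t ∧ y t ∈ K ∧ ‖y t - y 0‖ ≤ L * t) :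
    ‖g (x h) - g (y h) + (h ^ 2 / 2) • B (x 0) (l - l')‖ ≤ 5 * L ^ 3 * h ^ 3 * ‖l - l'‖ := by
  have hL := zero_lt_one.trans_le H.L1
  have hxy := H.lipFlow hl hl' hh h0 (fun t ht => ⟨(hx t ht).1, (hx t ht).2.1⟩)
    (fun t ht => ⟨(hy t ht).1, (hy t ht).2.1⟩)
  have key := mvt2 (h := h) (ε := 5 * L ^ 3 * h * ‖l - l'‖) (by positivity)
    (D := fun t => g (x t) - g (y t) + (t ^ 2 / 2) • B (x 0) (l - l'))
    (D' := fun t => w (x t) - w (y t) + t • B (x 0) (l - l'))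
    (D'' := fun t => B (x t) (μ (x t) - l) - B (y t) (μ (y t) - l') + B (x 0) (l - l'))
    ?_ ?_ (by simp [h0]) (by simp [h0]) ?_ h ⟨hpos, le_rfl⟩
  · refine key.1.trans (le_of_eq ?_); ring
  · intro t ht
    refine ((H.along (hx t ht).1 (hx t ht).2.1).1.sub
      (H.along (hy t ht).1 (hy t ht).2.1).1).add (HasDerivAt.smul_const ?_ _)
    have := (hasDerivAt_pow 2 t).div_const 2
    simpa using this
  · intro t ht
    refine ((H.along (hx t ht).1 (hx t ht).2.1).2.1.sub
      (H.along (hy t ht).1 (hy t ht).2.1).2.1).add ?_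
    simpa using (hasDerivAt_id t).smul_const (B (x 0) (l - l'))
  · intro t ht
    have e : B (x t) (μ (x t) - l) - B (y t) (μ (y t) - l') + B (x 0) (l - l')
        = (B (x t) (μ (x t)) - B (y t) (μ (y t))) - (B (x t) - B (x 0)) (l - l')
          - (B (x t) - B (y t)) l' := by
      simp only [map_sub, _root_.sub_apply]; abel
    have hKx := (hx t ht).2.1
    have hKy := (hy t ht).2.1
    have a1 : ‖B (x t) (μ (x t)) - B (y t) (μ (y t))‖ ≤ L * (2 * L * h * ‖l - l'‖) :=
      (H.cL _ hKx _ hKy).trans (by gcongr; exact hxy t ht)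
    have a2 : ‖(B (x t) - B (x 0)) (l - l')‖ ≤ L * (L * h) * ‖l - l'‖ := by
      refine (ContinuousLinearMap.le_opNorm _ _).trans ?_
      gcongr
      refine (H.BL _ hKx _ hx0).trans ?_
      gcongr
      refine (hx t ht).2.2.trans ?_
      gcongr; exact ht.2
    have a3 : ‖(B (x t) - B (y t)) l'‖ ≤ L * (2 * L * h * ‖l - l'‖) * L := by
      refine (ContinuousLinearMap.le_opNorm _ _).trans ?_
      gcongr
      · exact (H.BL _ hKx _ hKy).trans (by gcongr; exact hxy t ht)
      · exact hl'.trans H.RL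
    have L1 := H.L1
    calc _ ≤ _ := by rw [e]
      _ ≤ ‖B (x t) (μ (x t)) - B (y t) (μ (y t))‖ + ‖(B (x t) - B (x 0)) (l - l')‖
          + ‖(B (x t) - B (y t)) l'‖ := (norm_sub_le _ _).trans (by gcongr; exact norm_sub_le _ _)
      _ ≤ L * (2 * L * h * ‖l - l'‖) + L * (L * h) * ‖l - l'‖
          + L * (2 * L * h * ‖l - l'‖) * L := by gcongr
      _ = (3 * L ^ 2 + 2 * L ^ 3) * (h * ‖l - l'‖) := by ring
      _ ≤ (5 * L ^ 3) * (h * ‖l - l'‖) := by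
          gcongr
          have : L ^ 2 ≤ L ^ 3 := pow_le_pow_right₀ L1 (by norm_num)
          linarith
      _ = 5 * L ^ 3 * h * ‖l - l'‖ := by ring

theorem Bd.gzero (H : Bd f g w B Bi μ Γ K' K L R ρ) {x : ℝ → X} {h : ℝ}
    (hpos : 0 ≤ h) (hx0 : x 0 ∈ K) (hg0 : g (x 0) = 0)
    (hx : ∀ t ∈ Icc (0:ℝ) h, HasDerivAt x (f (x t, μ (x 0))) t ∧ x t ∈ K ∧ ‖x t - x 0‖ ≤ L * t) :
    ‖g (x h)‖ ≤ h * ‖w (x 0)‖ + L ^ 3 * h ^ 3 := by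
  have hL := zero_lt_one.trans_le H.L1
  have key := mvt2 (h := h) (ε := L ^ 3 * h) (by positivity)
    (D := fun t => g (x t) - t • w (x 0))
    (D' := fun t => w (x t) - w (x 0))
    (D'' := fun t => B (x t) (μ (x t) - μ (x 0)))
    ?_ ?_ (by simp [hg0]) (by simp) ?_ h ⟨hpos, le_rfl⟩
  · have := norm_le_norm_add_norm_sub' (g (x h)) (h • w (x 0))
    rw [norm_smul, Real.norm_of_nonneg hpos] at this
    refine this.trans ?_
    have := key.1
    nlinarith
  · intro t ht
    refine (H.along (hx t ht).1 (hx t ht).2.1).1.sub ?_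
    simpa using (hasDerivAt_id t).smul_const (w (x 0))
  · intro t ht
    exact (H.along (hx t ht).1 (hx t ht).2.1).2.1.sub_const _
  · intro t ht
    have hKx := (hx t ht).2.1
    refine (ContinuousLinearMap.le_opNorm _ _).trans ?_
    calc _ ≤ L * (L * (L * h)) := by
          refine mul_le_mul (H.BB _ hKx) ((H.μL _ hKx _ hx0).trans ?_) (norm_nonneg _) hL.le
          gcongr
          exact (hx t ht).2.2.trans (by gcongr; exact ht.2)
      _ = L ^ 3 * h := by ring

theorem Bd.solve [CompleteSpace X] [CompleteSpace F] (H : Bd f g w B Bi μ Γ K' K L R ρ)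
    {x₀ : X} (hx₀ : x₀ ∈ K') (hg0 : g x₀ = 0) {h : ℝ} (hpos : 0 < h) (h1 : h ≤ ρ / (2 * L))
    (h2 : 20 * L ^ 4 * h ≤ 1) (h3 : 4 * L ^ 4 * (‖w x₀‖ / h + h) ≤ 1) :
    ∃ (l : F) (x : ℝ → X), x 0 = x₀ ∧ ‖l - μ x₀‖ ≤ 4 * L ^ 4 * (‖w x₀‖ / h + h) ∧
      (∀ t ∈ Icc (0:ℝ) h, HasDerivAt x (f (x t, l)) t ∧ x t ∈ K ∧ ‖x t - x 0‖ ≤ L * t) ∧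
      g (x h) = 0 := by
  have L1 := H.L1
  have hL := zero_lt_one.trans_le L1
  have hx₀K : x₀ ∈ K := H.KK x₀ hx₀ (Metric.mem_closedBall_self H.ρ0.le)
  have hLh : L * h ≤ 1 := by
    have : L ≤ L ^ 4 := le_self_pow₀ L1 (by norm_num)
    nlinarith
  have hfl : ∀ l : F, ∃ x : ℝ → X, ‖l‖ ≤ R → x 0 = x₀ ∧ ∀ t ∈ Icc (0:ℝ) h,
      HasDerivAt x (f (x t, l)) t ∧ x t ∈ K ∧ ‖x t - x 0‖ ≤ L * t := by
    intro l
    by_cases hl : ‖l‖ ≤ R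
    · obtain ⟨x, hx0, hx⟩ := H.flow x₀ hx₀ l hl
      refine ⟨x, fun _ => ⟨hx0, fun t ht => ?_⟩⟩
      have := hx t ⟨ht.1, ht.2.trans h1⟩
      rwa [hx0]
    · exact ⟨fun _ => 0, fun h => absurd h hl⟩
  choose ξ hξ using hfl
  set r := 4 * L ^ 4 * (‖w x₀‖ / h + h) with hr
  have hr0 : 0 ≤ r := by positivity
  have hball : ∀ l ∈ Metric.closedBall (μ x₀) r, ‖l‖ ≤ R := by
    intro l hl
    rw [Metric.mem_closedBall, dist_eq_norm] at hl
    have := norm_le_norm_add_norm_sub' l (μ x₀)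
    have := H.μB x₀ hx₀K
    linarith
  have hex : ∃ l ∈ Metric.closedBall (μ x₀) r, l + (2 / h ^ 2) • Bi x₀ (g (ξ l h)) = l := by
    refine contr (Ψ := fun l => l + (2 / h ^ 2) • Bi x₀ (g (ξ l h))) hr0 ?_ ?_
    · intro l hl l' hl'
      have a := hξ l (hball l hl)
      have b := hξ l' (hball l' hl')
      have key := H.gdiff (hball l hl) (hball l' hl') hpos.le hLh (a.1.trans b.1.symm)
        (a.1.symm ▸ hx₀K) a.2 b.2
      rw [a.1] at key
      have e : (l + (2 / h ^ 2) • Bi x₀ (g (ξ l h))) - (l' + (2 / h ^ 2) • Bi x₀ (g (ξ l' h)))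
        = (2 / h ^ 2) • Bi x₀ (g (ξ l h) - g (ξ l' h) + (h ^ 2 / 2) • B x₀ (l - l')) := by
        simp only [map_add, map_smul, H.BiBe x₀ hx₀K, map_sub, smul_add, smul_sub, smul_smul]
        have : 2 / h ^ 2 * (h ^ 2 / 2) = 1 := by field_simp
        rw [this, one_smul, one_smul]; abel
      simp only [e]
      rw [norm_smul, Real.norm_of_nonneg (by positivity)]
      calc _ ≤ 2 / h ^ 2 * (L * (5 * L ^ 3 * h ^ 3 * ‖l - l'‖)) := by
            gcongr
            refine (ContinuousLinearMap.le_opNorm _ _).trans ?_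
            gcongr
            exact H.BiB _ hx₀K
        _ = (10 * L ^ 4 * h) * ‖l - l'‖ := by field_simp; ring
        _ ≤ _ := by gcongr; linarith
    · have hμR : ‖μ x₀‖ ≤ R := hball _ (Metric.mem_closedBall_self hr0)
      have a := hξ _ hμR
      have key := H.gzero hpos.le (a.1.symm ▸ hx₀K) (by rw [a.1, hg0]) (by
        intro t ht
        have := a.2 t ht
        rw [a.1] at this ⊢
        exact this)
      rw [a.1] at key
      simp only [add_sub_cancel_left]
      rw [norm_smul, Real.norm_of_nonneg (by positivity)]
      have : L ≤ L ^ 4 := le_self_pow₀ L1 (by norm_num)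
      calc _ ≤ 2 / h ^ 2 * (L * (h * ‖w x₀‖ + L ^ 3 * h ^ 3)) := by
            gcongr
            refine (ContinuousLinearMap.le_opNorm _ _).trans ?_
            gcongr
            exact H.BiB _ hx₀K
        _ = 2 * L * (‖w x₀‖ / h) + 2 * L ^ 4 * h := by field_simp
        _ ≤ 2 * L ^ 4 * (‖w x₀‖ / h) + 2 * L ^ 4 * h := by gcongr
        _ = r / 2 := by rw [hr]; ring
  obtain ⟨l, hl, hfix⟩ := hex
  have hlR := hball l hl
  have := hξ l hlR
  refine ⟨l, ξ l, this.1, by rwa [← dist_eq_norm], this.2, ?_⟩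
  have e : (2 / h ^ 2) • Bi x₀ (g (ξ l h)) = 0 := by simpa using hfix
  rw [smul_eq_zero] at e
  have e2 := e.resolve_left (by positivity)
  rw [← H.BBi x₀ hx₀K (g (ξ l h)), e2, map_zero]

end abstractPart2

section abstractPart3

variable {X F : Type*} [NormedAddCommGroup X] [NormedSpace ℝ X]
  [NormedAddCommGroup F] [NormedSpace ℝ F]

variable {f : X × F → X} {g w : X → F} {B Bi : X → F →L[ℝ] F} {μ : X → F}
    {Γ : X × F → F} {K' K : Set X} {L R ρ : ℝ}

theorem Bd.wbound (H : Bd f g w B Bi μ Γ K' K L R ρ) {x : ℝ → X} {l : F} {h r : ℝ}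
    (hx0 : x 0 ∈ K) (hr : ‖l - μ (x 0)‖ ≤ r)
    (hx : ∀ t ∈ Icc (0:ℝ) h, HasDerivAt x (f (x t, l)) t ∧ x t ∈ K ∧ ‖x t - x 0‖ ≤ L * t) :
    ∀ t ∈ Icc (0:ℝ) h, ‖w (x t)‖ ≤ ‖w (x 0)‖ + L * (L ^ 2 * h + r) * h := by
  have hL := zero_lt_one.trans_le H.L1
  have hr0 : 0 ≤ r := (norm_nonneg _).trans hr
  intro t ht
  have hh : 0 ≤ h := ht.1.trans ht.2
  have := mvt0 (h := h) (ε := L * (L ^ 2 * h + r)) (D := fun t => w (x t))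
    (D' := fun t => B (x t) (μ (x t) - l))
    (fun t ht => (H.along (hx t ht).1 (hx t ht).2.1).2.1) ?_ t ht
  · have h2 := norm_le_norm_add_norm_sub' (w (x t)) (w (x 0))
    refine h2.trans ?_
    gcongr
    refine this.trans ?_
    gcongr
    exact ht.2
  · intro t ht
    have hKx := (hx t ht).2.1
    refine (ContinuousLinearMap.le_opNorm _ _).trans ?_
    refine mul_le_mul (H.BB _ hKx) ?_ (norm_nonneg _) hL.le
    have e : μ (x t) - l = (μ (x t) - μ (x 0)) - (l - μ (x 0)) := by abel
    rw [e]
    refine (norm_sub_le _ _).trans (add_le_add ((H.μL _ hKx _ hx0).trans ?_) hr)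
    rw [pow_two, mul_assoc]
    gcongr
    exact (hx t ht).2.2.trans (by gcongr; exact ht.2)

theorem Bd.trap (H : Bd f g w B Bi μ Γ K' K L R ρ) {x : ℝ → X} {l : F} {h : ℝ}
    (hl : ‖l‖ ≤ R) (hx0 : x 0 ∈ K) (hpos : 0 < h) (hg0 : g (x 0) = 0) (hgh : g (x h) = 0)
    (hx : ∀ t ∈ Icc (0:ℝ) h, HasDerivAt x (f (x t, l)) t ∧ x t ∈ K ∧ ‖x t - x 0‖ ≤ L * t) :
    ‖w (x h) + w (x 0) - (h ^ 2 / 6) • Γ (x 0, l)‖ ≤ 3 * L ^ 2 * h ^ 3 := by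
  have hL := zero_lt_one.trans_le H.L1
  set Γ₀ := Γ (x 0, l) with hΓ₀
  set b0 := B (x 0) (μ (x 0) - l) with hb0
  have d2 : ∀ t : ℝ, HasDerivAt (fun t : ℝ => t ^ 2 / 2) t t := fun t => by
    simpa using (hasDerivAt_pow 2 t).div_const 2
  have d3 : ∀ t : ℝ, HasDerivAt (fun t : ℝ => t ^ 3 / 6) (t ^ 2 / 2) t := fun t => by
    refine ((hasDerivAt_pow 3 t).div_const 6).congr_deriv ?_
    norm_num; ring
  have d1 : ∀ (t : ℝ) (v : F), HasDerivAt (fun t : ℝ => t • v) v t := fun t v => by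
    simpa using (hasDerivAt_id t).smul_const v
  have k2 := mvt2 (h := h) (ε := L ^ 2 * h) (by positivity)
    (D := fun t => w (x t) - w (x 0) - t • b0 - (t ^ 2 / 2) • Γ₀)
    (D' := fun t => B (x t) (μ (x t) - l) - b0 - t • Γ₀)
    (D'' := fun t => Γ (x t, l) - Γ₀)
    (fun t ht => (((H.along (hx t ht).1 (hx t ht).2.1).2.1.sub_const _).sub (d1 t b0)).sub
      ((d2 t).smul_const Γ₀))
    (fun t ht => ((H.along (hx t ht).1 (hx t ht).2.1).2.2.sub_const _).sub (d1 t Γ₀))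
    (by simp) (by simp [hb0])
    (fun t ht => by
      have := H.ΓL _ (hx t ht).2.1 l hl _ hx0 l hl
      rw [sub_self, norm_zero, add_zero] at this
      refine this.trans ?_
      rw [pow_two, mul_assoc]
      gcongr
      exact (hx t ht).2.2.trans (by gcongr; exact ht.2))
  have hmem : h ∈ Icc (0:ℝ) h := ⟨hpos.le, le_rfl⟩
  have k3 := mvt0 (h := h) (ε := L ^ 2 * h * h ^ 2)
    (D := fun t => g (x t) - t • w (x 0) - (t ^ 2 / 2) • b0 - (t ^ 3 / 6) • Γ₀)
    (D' := fun t => w (x t) - w (x 0) - t • b0 - (t ^ 2 / 2) • Γ₀)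
    (fun t ht => (((H.along (hx t ht).1 (hx t ht).2.1).1.sub (d1 t _)).sub
      ((d2 t).smul_const b0)).sub ((d3 t).smul_const Γ₀))
    (fun t ht => (k2 t ht).1) h hmem
  have k2h := (k2 h hmem).1
  simp only [hg0, hgh, zero_smul, sub_zero, zero_sub, ne_eq, OfNat.ofNat_ne_zero,
    not_false_eq_true, zero_pow, zero_div] at k3
  have e : w (x h) + w (x 0) - (h ^ 2 / 6) • Γ₀
      = (w (x h) - w (x 0) - h • b0 - (h ^ 2 / 2) • Γ₀)
        - (2 / h) • (-(h • w (x 0)) - (h ^ 2 / 2) • b0 - (h ^ 3 / 6) • Γ₀) := by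
    simp only [smul_sub, smul_neg, smul_smul]
    have e1 : 2 / h * h = 2 := by field_simp
    have e2 : 2 / h * (h ^ 2 / 2) = h := by field_simp
    have e3 : 2 / h * (h ^ 3 / 6) = h ^ 2 / 3 := by field_simp; norm_num
    rw [e1, e2, e3]
    module
  rw [e]
  refine (norm_sub_le _ _).trans ?_
  rw [norm_smul, Real.norm_of_nonneg (by positivity : (0:ℝ) ≤ 2 / h)]
  calc _ ≤ L ^ 2 * h * h ^ 2 + 2 / h * (L ^ 2 * h * h ^ 2 * h) := by gcongr
    _ = 3 * L ^ 2 * h ^ 3 := by field_simp; ring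

/-- One step of the method. -/
theorem Bd.step [CompleteSpace X] [CompleteSpace F] (H : Bd f g w B Bi μ Γ K' K L R ρ)
    {x₀ : X} (hx₀ : x₀ ∈ K') (hg0 : g x₀ = 0) {h : ℝ} (hpos : 0 < h) (h1 : h ≤ ρ / (2 * L))
    (h2 : 20 * L ^ 4 * h ≤ 1) (h3 : 4 * L ^ 4 * (‖w x₀‖ / h + h) ≤ 1) :
    ∃ (l : F) (x : ℝ → X), x 0 = x₀ ∧ ‖l - μ x₀‖ ≤ 8 * L ^ 5 * (‖w x₀‖ / h + h) ∧
      (∀ t ∈ Icc (0:ℝ) h, HasDerivAt x (f (x t, l)) t ∧ x t ∈ K ∧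
        ‖w (x t)‖ ≤ 8 * L ^ 5 * (‖w x₀‖ + h ^ 2)) ∧
      g (x h) = 0 ∧
      ‖w (x h) - (h ^ 2 / 12) • Γ (x h, μ (x h))‖ ≤ ‖w x₀ - (h ^ 2 / 12) • Γ (x₀, μ x₀)‖
        + 8 * L ^ 5 * h * (‖w x₀‖ + h ^ 2) := by
  have L1 := H.L1
  have hL := zero_lt_one.trans_le L1
  have hx₀K : x₀ ∈ K := H.KK x₀ hx₀ (Metric.mem_closedBall_self H.ρ0.le)
  obtain ⟨l, x, hx0, hlr, hx, hgh⟩ := H.solve hx₀ hg0 hpos h1 h2 h3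
  set r := 4 * L ^ 4 * (‖w x₀‖ / h + h) with hr
  have p2 : L ^ 2 ≤ L ^ 5 := pow_le_pow_right₀ L1 (by norm_num)
  have p3 : L ^ 3 ≤ L ^ 5 := pow_le_pow_right₀ L1 (by norm_num)
  have p4 : L ^ 4 ≤ L ^ 5 := pow_le_pow_right₀ L1 (by norm_num)
  have p0 : 1 ≤ L ^ 5 := one_le_pow₀ L1
  have hrh : r * h = 4 * L ^ 4 * (‖w x₀‖ + h ^ 2) := by rw [hr]; field_simp
  have hμ := H.μB x₀ hx₀K
  have hlR : ‖l‖ ≤ R := by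
    have := norm_le_norm_add_norm_sub' l (μ x₀)
    linarith
  have hmem : h ∈ Icc (0:ℝ) h := ⟨hpos.le, le_rfl⟩
  have hxh := (hx h hmem).2
  refine ⟨l, x, hx0, hlr.trans ?_, fun t ht => ⟨(hx t ht).1, (hx t ht).2.1, ?_⟩, hgh, ?_⟩
  · rw [hr]; gcongr; norm_num
  · have := H.wbound (r := r) (hx0.symm ▸ hx₀K) (by rw [hx0]; exact hlr) hx t ht
    rw [hx0] at this
    refine this.trans ?_
    have e : L * (L ^ 2 * h + r) * h = L ^ 3 * h ^ 2 + L * (r * h) := by ring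
    rw [e, hrh]
    have hw := norm_nonneg (w x₀)
    have : L ^ 3 * h ^ 2 ≤ L ^ 5 * h ^ 2 := by gcongr
    have : 1 * ‖w x₀‖ ≤ L ^ 5 * ‖w x₀‖ := by gcongr
    have : 0 ≤ L ^ 5 * ‖w x₀‖ := by positivity
    have : 0 ≤ L ^ 5 * h ^ 2 := by positivity
    nlinarith
  · have kt := H.trap hlR (hx0.symm ▸ hx₀K) hpos (by rw [hx0, hg0]) hgh hx
    rw [hx0] at kt hxh
    have a1 : ‖Γ (x₀, l) - Γ (x₀, μ x₀)‖ ≤ L * r := by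
      have := H.ΓL _ hx₀K l hlR _ hx₀K (μ x₀) (by linarith)
      rw [sub_self, norm_zero, zero_add] at this
      exact this.trans (by gcongr)
    have a2 : ‖Γ (x h, μ (x h)) - Γ (x₀, μ x₀)‖ ≤ L * (L * h + L * (L * h)) := by
      have hμh := H.μB _ hxh.1
      refine (H.ΓL _ hxh.1 (μ (x h)) (by linarith) _ hx₀K (μ x₀) (by linarith)).trans ?_
      gcongr
      · exact hxh.2
      · exact (H.μL _ hxh.1 _ hx₀K).trans (by gcongr; exact hxh.2)
    have e : w (x h) - (h ^ 2 / 12) • Γ (x h, μ (x h))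
        = (w (x h) + w x₀ - (h ^ 2 / 6) • Γ (x₀, l))
          + (h ^ 2 / 6) • (Γ (x₀, l) - Γ (x₀, μ x₀))
          - (h ^ 2 / 12) • (Γ (x h, μ (x h)) - Γ (x₀, μ x₀))
          - (w x₀ - (h ^ 2 / 12) • Γ (x₀, μ x₀)) := by module
    rw [e]
    calc _ ≤ ‖w (x h) + w x₀ - (h ^ 2 / 6) • Γ (x₀, l)‖
          + ‖(h ^ 2 / 6) • (Γ (x₀, l) - Γ (x₀, μ x₀))‖
          + ‖(h ^ 2 / 12) • (Γ (x h, μ (x h)) - Γ (x₀, μ x₀))‖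
          + ‖w x₀ - (h ^ 2 / 12) • Γ (x₀, μ x₀)‖ := by
          refine (norm_sub_le _ _).trans ?_
          gcongr
          refine (norm_sub_le _ _).trans ?_
          gcongr
          exact norm_add_le _ _
      _ ≤ 3 * L ^ 2 * h ^ 3 + (h ^ 2 / 6) * (L * r) + (h ^ 2 / 12) * (L * (L * h + L * (L * h)))
          + ‖w x₀ - (h ^ 2 / 12) • Γ (x₀, μ x₀)‖ := by
          rw [norm_smul, norm_smul, Real.norm_of_nonneg (by positivity : (0:ℝ) ≤ h ^ 2 / 6),
            Real.norm_of_nonneg (by positivity : (0:ℝ) ≤ h ^ 2 / 12)]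
          gcongr
      _ ≤ _ := by
          have e1 : (h ^ 2 / 6) * (L * r) = (4 / 6) * L ^ 5 * h * (‖w x₀‖ + h ^ 2) := by
            have : (h ^ 2 / 6) * (L * r) = h / 6 * L * (r * h) := by ring
            rw [this, hrh]; ring
          rw [e1]
          have b1 : L ^ 2 * h ^ 3 ≤ L ^ 5 * h ^ 3 := by gcongr
          have b2 : L ^ 3 * h ^ 3 ≤ L ^ 5 * h ^ 3 := by gcongr
          have b3 : 0 ≤ L ^ 5 * h * ‖w x₀‖ := by positivity
          have b4 : 0 ≤ L ^ 5 * h ^ 3 := by positivity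
          nlinarith

end abstractPart3

section abstractPart4

variable {X F : Type*} [NormedAddCommGroup X] [NormedSpace ℝ X]
  [NormedAddCommGroup F] [NormedSpace ℝ F]

variable {f : X × F → X} {g w : X → F} {B Bi : X → F →L[ℝ] F} {μ : X → F}
    {Γ : X × F → F} {K' K : Set X} {L R ρ : ℝ}

theorem Bd.errStep (H : Bd f g w B Bi μ Γ K' K L R ρ) {Pi Φ : X → X}
    (hP : ∀ x ∈ K, ‖x - Pi x‖ ≤ L * ‖w x‖)
    (hPD : ∀ x ∈ K, ∀ l : F, ∃ P' : X →L[ℝ] X, HasFDerivAt Pi P' x ∧ P' (f (x, l)) = Φ x)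
    (hΦ : ∀ x ∈ K, ∀ y ∈ K, ‖Φ x - Φ y‖ ≤ L * ‖x - y‖)
    {x Z : ℝ → X} {l : F} {h W : ℝ} (hh : 0 ≤ h)
    (hx : ∀ t ∈ Icc (0:ℝ) h, HasDerivAt x (f (x t, l)) t ∧ x t ∈ K ∧ ‖w (x t)‖ ≤ W)
    (hZ : ∀ t ∈ Icc (0:ℝ) h, HasDerivAt Z (Φ (Z t)) t ∧ Z t ∈ K) :
    ‖Pi (x h) - Z h‖ + L * W ≤ Real.exp (L * h) * (‖Pi (x 0) - Z 0‖ + L * W) := by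
  have hL := zero_lt_one.trans_le H.L1
  have key := grw (D := fun t => Pi (x t) - Z t) (D' := fun t => Φ (x t) - Φ (Z t))
    (h := h) (ε := L * (L * W)) (δ := ‖Pi (x 0) - Z 0‖) hL
    (fun t ht => by
      obtain ⟨P', h1, h2⟩ := hPD _ (hx t ht).2.1 l
      refine HasDerivAt.sub ?_ (hZ t ht).1
      rw [← h2]; exact h1.comp_hasDerivAt t (hx t ht).1) le_rfl
    (fun t ht => by
      refine (hΦ _ (hx t ht).2.1 _ (hZ t ht).2).trans ?_
      rw [← mul_add]
      gcongr
      have e : x t - Z t = (Pi (x t) - Z t) + (x t - Pi (x t)) := by abel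
      rw [e]
      refine (norm_add_le _ _).trans ?_
      gcongr
      refine (hP _ (hx t ht).2.1).trans ?_
      gcongr
      exact (hx t ht).2.2) h ⟨hh, le_rfl⟩
  rw [mul_div_cancel_left₀ _ hL.ne'] at key
  linarith

set_option maxHeartbeats 1000000 in
theorem Bd.main [CompleteSpace X] [CompleteSpace F] (H : Bd f g w B Bi μ Γ K' K L R ρ)
    {Pi Φ : X → X}
    (hP : ∀ x ∈ K, ‖x - Pi x‖ ≤ L * ‖w x‖)
    (hPD : ∀ x ∈ K, ∀ l : F, ∃ P' : X →L[ℝ] X, HasFDerivAt Pi P' x ∧ P' (f (x, l)) = Φ x)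
    (hΦ : ∀ x ∈ K, ∀ y ∈ K, ‖Φ x - Φ y‖ ≤ L * ‖x - y‖)
    {Z : ℝ → X} {T : ℝ} (hT : 0 < T)
    (hZ : ∀ t ∈ Icc (0:ℝ) T, HasDerivAt Z (Φ (Z t)) t ∧ Metric.closedBall (Z t) ρ ⊆ K')
    (hg0 : g (Z 0) = 0) (hw0 : w (Z 0) = 0) :
    ∃ h₀ > 0, ∃ C > 0, ∀ N : ℕ, 0 < N → T / (N : ℝ) ≤ h₀ →
      ∃ (xa : ℕ → X) (lam : ℕ → F) (x : ℕ → ℝ → X), xa 0 = Z 0 ∧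
      (∀ n < N, x n 0 = xa n ∧
        (∀ t ∈ Icc (0:ℝ) (T / (N : ℝ)), HasDerivAt (x n) (f (x n t, lam n)) t ∧ x n t ∈ K) ∧
        xa (n + 1) = x n (T / (N : ℝ)) ∧
        ‖lam n - μ (Z ((n : ℝ) * (T / (N : ℝ))))‖ ≤ C * (T / (N : ℝ))) ∧
      (∀ n ≤ N, g (xa n) = 0 ∧ ‖xa n - Z ((n : ℝ) * (T / (N : ℝ)))‖ ≤ C * (T / (N : ℝ)) ^ 2 ∧
        ‖w (xa n)‖ ≤ C * (T / (N : ℝ)) ^ 2) := by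
  have L1 := H.L1
  have hL := zero_lt_one.trans_le L1
  obtain ⟨C₀, hC₀⟩ : ∃ c : ℝ, c = 8 * L ^ 5 := ⟨_, rfl⟩
  obtain ⟨A, hA⟩ : ∃ c : ℝ, c = Real.exp (C₀ * T) * (2 * L + 1) := ⟨_, rfl⟩
  obtain ⟨W₂, hW₂⟩ : ∃ c : ℝ, c = C₀ * (A + 1) := ⟨_, rfl⟩
  obtain ⟨E, hE⟩ : ∃ c : ℝ, c = Real.exp (L * T) * (L * W₂) := ⟨_, rfl⟩
  obtain ⟨C₂, hC₂⟩ : ∃ c : ℝ, c = E + L * A := ⟨_, rfl⟩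
  have pC₀ : 0 < C₀ := by rw [hC₀]; positivity
  have pA : 0 < A := by rw [hA]; positivity
  have pW₂ : 0 < W₂ := by rw [hW₂]; positivity
  have pE : 0 < E := by rw [hE]; positivity
  have pC₂ : 0 < C₂ := by rw [hC₂]; positivity
  have pρ := H.ρ0
  have hK'K : ∀ x ∈ K', x ∈ K := fun x hx => H.KK x hx (Metric.mem_closedBall_self pρ.le)
  refine ⟨min (min 1 (ρ / (2 * L))) (min (1 / (20 * L ^ 4))
    (min (1 / (4 * L ^ 4 * (A + 1))) (ρ / C₂))), by positivity,
    C₀ * (A + 1) + L * C₂ + C₂ + A, by positivity, ?_⟩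
  intro N hN hNh
  set h := T / (N : ℝ) with hh
  have hNpos : (0:ℝ) < N := by exact_mod_cast hN
  have hpos : 0 < h := by positivity
  have hNT : (N : ℝ) * h = T := by rw [hh]; field_simp
  simp only [le_min_iff] at hNh
  obtain ⟨⟨b1, b2⟩, b3, b4, b5⟩ := hNh
  rw [le_div_iff₀ (by positivity)] at b3 b4 b5
  have hst : ∀ x₀ : X, ∃ (l : F) (x : ℝ → X), x₀ ∈ K' → g x₀ = 0 → ‖w x₀‖ ≤ A * h ^ 2 →
      x 0 = x₀ ∧ ‖l - μ x₀‖ ≤ C₀ * (‖w x₀‖ / h + h) ∧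
      (∀ t ∈ Icc (0:ℝ) h, HasDerivAt x (f (x t, l)) t ∧ x t ∈ K ∧
        ‖w (x t)‖ ≤ C₀ * (‖w x₀‖ + h ^ 2)) ∧
      g (x h) = 0 ∧
      ‖w (x h) - (h ^ 2 / 12) • Γ (x h, μ (x h))‖ ≤ ‖w x₀ - (h ^ 2 / 12) • Γ (x₀, μ x₀)‖
        + C₀ * h * (‖w x₀‖ + h ^ 2) := by
    intro x₀
    by_cases hc : x₀ ∈ K' ∧ g x₀ = 0 ∧ ‖w x₀‖ ≤ A * h ^ 2
    · obtain ⟨c1, c2, c3⟩ := hc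
      rw [hC₀]
      obtain ⟨l, x, hx⟩ := H.step c1 c2 hpos b2 (by linarith) (by
        have : ‖w x₀‖ / h ≤ A * h := by
          rw [div_le_iff₀ hpos]; linarith
        calc 4 * L ^ 4 * (‖w x₀‖ / h + h) ≤ 4 * L ^ 4 * (A * h + h) := by gcongr
          _ = h * (4 * L ^ 4 * (A + 1)) := by ring
          _ ≤ 1 := b4)
      exact ⟨l, x, fun _ _ _ => hx⟩
    · exact ⟨0, fun _ => 0, fun c1 c2 c3 => absurd ⟨c1, c2, c3⟩ hc⟩
  choose Λ ξ hξ using hst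
  let xa : ℕ → X := fun n => Nat.rec (Z 0) (fun _ y => ξ y h) n
  have xa0 : xa 0 = Z 0 := rfl
  have xas : ∀ n, xa (n + 1) = ξ (xa n) h := fun n => rfl
  have tmem : ∀ n : ℕ, n ≤ N → (n : ℝ) * h ∈ Icc (0:ℝ) T := by
    intro n hn
    have : (n : ℝ) ≤ N := by exact_mod_cast hn
    exact ⟨by positivity, by rw [← hNT]; gcongr⟩
  -- consequences of the invariant
  have cons : ∀ n ≤ N, xa n ∈ K → 
      ‖w (xa n) - (h ^ 2 / 12) • Γ (xa n, μ (xa n))‖ + (L + 1) * h ^ 2 ≤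
        Real.exp (C₀ * (n * h)) * ((2 * L + 1) * h ^ 2) → 
      ‖Pi (xa n) - Z (n * h)‖ + L * (W₂ * h ^ 2) ≤
        Real.exp (L * (n * h)) * (L * (W₂ * h ^ 2)) →
      ‖w (xa n)‖ ≤ A * h ^ 2 ∧ ‖xa n - Z (n * h)‖ ≤ C₂ * h ^ 2 ∧ xa n ∈ K' ∧
      ‖w (xa n)‖ ≤ ‖w (xa n) - (h ^ 2 / 12) • Γ (xa n, μ (xa n))‖ + L * h ^ 2 := by
    intro n hn hK hz he
    have hw1 : ‖w (xa n)‖ ≤ ‖w (xa n) - (h ^ 2 / 12) • Γ (xa n, μ (xa n))‖ + L * h ^ 2 := by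
      have h1 := norm_le_norm_sub_add (w (xa n)) ((h ^ 2 / 12) • Γ (xa n, μ (xa n)))
      refine h1.trans ?_
      gcongr
      rw [norm_smul, Real.norm_of_nonneg (by positivity : (0:ℝ) ≤ h ^ 2 / 12)]
      have h2 := H.ΓB _ hK (μ (xa n)) (by linarith [H.μB _ hK])
      calc _ ≤ h ^ 2 / 12 * L := by gcongr
        _ ≤ L * h ^ 2 := by nlinarith [mul_pos hL (pow_pos hpos 2)]
    have ht := tmem n hn
    have hw : ‖w (xa n)‖ ≤ A * h ^ 2 := by
      have h3 : Real.exp (C₀ * (n * h)) * ((2 * L + 1) * h ^ 2) ≤ A * h ^ 2 := by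
        calc _ ≤ Real.exp (C₀ * T) * ((2 * L + 1) * h ^ 2) := by gcongr; exact ht.2
          _ = A * h ^ 2 := by rw [hA]; ring
      have h4 : 0 < h ^ 2 := by positivity
      linarith
    have hx : ‖xa n - Z (n * h)‖ ≤ C₂ * h ^ 2 := by
      have h4 : Real.exp (L * (n * h)) * (L * (W₂ * h ^ 2)) ≤ E * h ^ 2 := by
        calc _ ≤ Real.exp (L * T) * (L * (W₂ * h ^ 2)) := by gcongr; exact ht.2
          _ = _ := by rw [hE]; ring
      have h5 := hP _ hK
      have h6 : L * ‖w (xa n)‖ ≤ L * (A * h ^ 2) := by gcongr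
      have h7 : 0 ≤ L * (W₂ * h ^ 2) := by positivity
      have e : xa n - Z (n * h) = (xa n - Pi (xa n)) + (Pi (xa n) - Z (n * h)) := by abel
      rw [e]
      refine (norm_add_le _ _).trans ?_
      have h8 : C₂ * h ^ 2 = E * h ^ 2 + L * (A * h ^ 2) := by rw [hC₂]; ring
      linarith
    refine ⟨hw, hx, (hZ _ ht).2 ?_, hw1⟩
    rw [Metric.mem_closedBall, dist_eq_norm]
    refine hx.trans ?_
    have h9 : h ^ 2 ≤ h := by
      rw [pow_two]; exact mul_le_of_le_one_left hpos.le b1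
    calc C₂ * h ^ 2 ≤ C₂ * h := by gcongr
      _ = h * C₂ := mul_comm _ _
      _ ≤ ρ := b5
  have inv : ∀ n ≤ N, xa n ∈ K ∧ g (xa n) = 0 ∧
      ‖w (xa n) - (h ^ 2 / 12) • Γ (xa n, μ (xa n))‖ + (L + 1) * h ^ 2 ≤
        Real.exp (C₀ * (n * h)) * ((2 * L + 1) * h ^ 2) ∧
      ‖Pi (xa n) - Z (n * h)‖ + L * (W₂ * h ^ 2) ≤
        Real.exp (L * (n * h)) * (L * (W₂ * h ^ 2)) := by
    intro n
    induction n with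
    | zero =>
      intro _
      have hK : Z 0 ∈ K := hK'K _ ((hZ 0 ⟨le_rfl, hT.le⟩).2 (Metric.mem_closedBall_self pρ.le))
      refine ⟨hK, hg0, ?_, ?_⟩
      · rw [xa0, hw0]
        simp only [zero_sub, norm_neg, CharP.cast_eq_zero, zero_mul, mul_zero, Real.exp_zero,
          one_mul]
        rw [norm_smul, Real.norm_of_nonneg (by positivity : (0:ℝ) ≤ h ^ 2 / 12)]
        have h2 := H.ΓB _ hK (μ (Z 0)) (by linarith [H.μB _ hK])
        have : h ^ 2 / 12 * ‖Γ (Z 0, μ (Z 0))‖ ≤ h ^ 2 / 12 * L := by gcongr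
        nlinarith [mul_pos hL (pow_pos hpos 2)]
      · have h1 := hP _ hK
        rw [hw0, norm_zero, mul_zero] at h1
        have h2 : ‖Pi (Z 0) - Z 0‖ ≤ 0 := by rwa [norm_sub_rev]
        simp only [xa0, CharP.cast_eq_zero, zero_mul, mul_zero, Real.exp_zero, one_mul]
        linarith
    | succ n ih =>
      intro hn
      have hn' : n ≤ N := by omega
      obtain ⟨i1, i2, i3, i4⟩ := ih hn'
      obtain ⟨c1, c2, c3, c4⟩ := cons n hn' i1 i3 i4
      obtain ⟨s1, s2, s3, s4, s5⟩ := hξ (xa n) c3 i2 c1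
      have hmem : h ∈ Icc (0:ℝ) h := ⟨hpos.le, le_rfl⟩
      have ht := tmem n hn'
      have ht1 := tmem (n + 1) hn
      push_cast at ht1
      refine ⟨(s3 h hmem).2.1, s4, ?_, ?_⟩
      · rw [xas]
        push_cast
        set z := ‖w (xa n) - (h ^ 2 / 12) • Γ (xa n, μ (xa n))‖
        calc _ ≤ z + C₀ * h * (‖w (xa n)‖ + h ^ 2) + (L + 1) * h ^ 2 := by gcongr
          _ ≤ z + C₀ * h * ((z + L * h ^ 2) + h ^ 2) + (L + 1) * h ^ 2 := by gcongr
          _ = (C₀ * h + 1) * (z + (L + 1) * h ^ 2) := by ring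
          _ ≤ Real.exp (C₀ * h) * (z + (L + 1) * h ^ 2) := by
              gcongr; exact Real.add_one_le_exp _
          _ ≤ Real.exp (C₀ * h) * (Real.exp (C₀ * (n * h)) * ((2 * L + 1) * h ^ 2)) := by gcongr
          _ = Real.exp (C₀ * ((n + 1) * h)) * ((2 * L + 1) * h ^ 2) := by
              rw [← mul_assoc, ← Real.exp_add]; congr 2; ring
      · rw [xas]
        have key := H.errStep hP hPD hΦ (x := ξ (xa n)) (Z := fun t => Z (n * h + t))
          (l := Λ (xa n)) (h := h) (W := W₂ * h ^ 2) hpos.le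
          (fun t ht' => ⟨(s3 t ht').1, (s3 t ht').2.1, (s3 t ht').2.2.trans (by
            rw [hW₂]
            have : ‖w (xa n)‖ + h ^ 2 ≤ (A + 1) * h ^ 2 := by linarith
            rw [mul_assoc]
            gcongr)⟩)
          (fun t ht' => by
            have hm : n * h + t ∈ Icc (0:ℝ) T := ⟨add_nonneg ht.1 ht'.1, by
              have := ht1.2; have := ht'.2; linarith⟩
            refine ⟨?_, hK'K _ ((hZ _ hm).2 (Metric.mem_closedBall_self pρ.le))⟩
            exact HasDerivAt.comp_const_add (n * h) t (hZ _ hm).1)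
        simp only [add_zero, s1] at key
        push_cast
        have e : ((n:ℝ) + 1) * h = n * h + h := by ring
        rw [e]
        calc _ ≤ _ := key
          _ ≤ Real.exp (L * h) * (Real.exp (L * (n * h)) * (L * (W₂ * h ^ 2))) := by gcongr
          _ = _ := by rw [← mul_assoc, ← Real.exp_add]; congr 2; ring
  have pLC : 0 < L * C₂ := by positivity
  have pCA : 0 < C₀ * (A + 1) := by positivity
  refine ⟨xa, fun n => Λ (xa n), fun n => ξ (xa n), xa0, fun n hn => ?_, fun n hn => ?_⟩
  · obtain ⟨i1, i2, i3, i4⟩ := inv n hn.le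
    obtain ⟨c1, c2, c3, c4⟩ := cons n hn.le i1 i3 i4
    obtain ⟨s1, s2, s3, s4, s5⟩ := hξ (xa n) c3 i2 c1
    refine ⟨s1, fun t ht => ⟨(s3 t ht).1, (s3 t ht).2.1⟩, xas n, ?_⟩
    have hZK : Z (n * h) ∈ K := hK'K _ ((hZ _ (tmem n hn.le)).2 (Metric.mem_closedBall_self pρ.le))
    have h1 : ‖μ (xa n) - μ (Z (n * h))‖ ≤ L * (C₂ * h ^ 2) :=
      (H.μL _ i1 _ hZK).trans (by gcongr)
    have h2 : ‖w (xa n)‖ / h ≤ A * h := by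
      rw [div_le_iff₀ hpos]; linarith
    have h3 : ‖Λ (xa n) - μ (xa n)‖ ≤ C₀ * (A * h + h) := s2.trans (by gcongr)
    have e : Λ (xa n) - μ (Z (n * h))
        = (Λ (xa n) - μ (xa n)) + (μ (xa n) - μ (Z (n * h))) := by abel
    rw [e]
    refine (norm_add_le _ _).trans ?_
    have h4 : L * (C₂ * h ^ 2) ≤ L * C₂ * h := by
      have : h ^ 2 ≤ h := by nlinarith
      calc _ = L * C₂ * h ^ 2 := by ring
        _ ≤ _ := by gcongr
    have h5 : 0 ≤ C₂ * h := by positivity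
    have h6 : 0 ≤ A * h := by positivity
    linarith
  · obtain ⟨i1, i2, i3, i4⟩ := inv n hn
    obtain ⟨c1, c2, c3, c4⟩ := cons n hn i1 i3 i4
    refine ⟨i2, c2.trans ?_, c1.trans ?_⟩
    · gcongr
      linarith
    · gcongr
      linarith

end abstractPart4

section abstractPart5

variable {X F : Type*} [NormedAddCommGroup X] [NormedSpace ℝ X] [FiniteDimensional ℝ X]
  [NormedAddCommGroup F] [NormedSpace ℝ F] [FiniteDimensional ℝ F]

theorem prodLip {Y : Type*} [NormedAddCommGroup Y] {K : Set X} {L R : ℝ} (hL : 0 ≤ L)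
    {φ : X × F → Y}
    (h : ∀ x ∈ K ×ˢ Metric.closedBall (0:F) R, ∀ y ∈ K ×ˢ Metric.closedBall (0:F) R,
      ‖φ x - φ y‖ ≤ L * ‖x - y‖) :
    ∀ x ∈ K, ∀ l : F, ‖l‖ ≤ R → ∀ y ∈ K, ∀ l' : F, ‖l'‖ ≤ R →
    ‖φ (x, l) - φ (y, l')‖ ≤ L * (‖x - y‖ + ‖l - l'‖) := by
  intro x hx l hl y hy l' hl'
  refine (h (x, l) ⟨hx, by simpa using hl⟩ (y, l') ⟨hy, by simpa using hl'⟩).trans ?_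
  gcongr
  rw [Prod.mk_sub_mk, Prod.norm_mk]
  exact max_le_add_of_nonneg (norm_nonneg _) (norm_nonneg _)

theorem smoothMain {f : X × F → X} {g w : X → F} {B Bi : X → F →L[ℝ] F} {μ : X → F}
    {k : X → F →L[ℝ] X} {Pi Φ : X → X} {Ω : Set X} (hΩ : IsOpen Ω)
    (sf : ContDiffOn ℝ 2 f (Ω ×ˢ univ)) (sB : ContDiffOn ℝ 2 B Ω) (sBi : ContDiffOn ℝ 2 Bi Ω)
    (sμ : ContDiffOn ℝ 2 μ Ω) (sk : ContDiffOn ℝ 1 k Ω) (sΦ : ContDiffOn ℝ 1 Φ Ω)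
    (hk : ∀ x ∈ Ω, x - Pi x = k x (w x))
    (gD : ∀ x ∈ Ω, ∀ l : F, ∃ g' : X →L[ℝ] F, HasFDerivAt g g' x ∧ g' (f (x, l)) = w x)
    (wD : ∀ x ∈ Ω, ∀ l : F, ∃ w' : X →L[ℝ] F, HasFDerivAt w w' x ∧
      w' (f (x, l)) = B x (μ x - l))
    (BBi : ∀ x ∈ Ω, ∀ η, B x (Bi x η) = η)
    (BiBe : ∀ x ∈ Ω, ∀ η, Bi x (B x η) = η)
    (hPD : ∀ x ∈ Ω, ∀ l : F, ∃ P' : X →L[ℝ] X, HasFDerivAt Pi P' x ∧ P' (f (x, l)) = Φ x)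
    {Z : ℝ → X} {T : ℝ} (hT : 0 < T)
    (hZ : ∀ t ∈ Icc (0:ℝ) T, HasDerivAt Z (Φ (Z t)) t ∧ Z t ∈ Ω)
    (hg0 : g (Z 0) = 0) (hw0 : w (Z 0) = 0) :
    ∃ h₀ > 0, ∃ C > 0, ∀ N : ℕ, 0 < N → T / (N : ℝ) ≤ h₀ →
      ∃ (xa : ℕ → X) (lam : ℕ → F) (x : ℕ → ℝ → X), xa 0 = Z 0 ∧
      (∀ n < N, x n 0 = xa n ∧
        (∀ t ∈ Icc (0:ℝ) (T / (N : ℝ)), HasDerivAt (x n) (f (x n t, lam n)) t ∧ x n t ∈ Ω) ∧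
        xa (n + 1) = x n (T / (N : ℝ)) ∧
        ‖lam n - μ (Z ((n : ℝ) * (T / (N : ℝ))))‖ ≤ C * (T / (N : ℝ))) ∧
      (∀ n ≤ N, g (xa n) = 0 ∧ ‖xa n - Z ((n : ℝ) * (T / (N : ℝ)))‖ ≤ C * (T / (N : ℝ)) ^ 2 ∧
        ‖w (xa n)‖ ≤ C * (T / (N : ℝ)) ^ 2) := by
  have : ProperSpace X := FiniteDimensional.proper ℝ X
  have : ProperSpace F := FiniteDimensional.proper ℝ F
  have : CompleteSpace X := FiniteDimensional.complete ℝ X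
  have : CompleteSpace F := FiniteDimensional.complete ℝ F
  have sc : ContDiffOn ℝ 2 (fun y => B y (μ y)) Ω := sB.clm_apply sμ
  let Γ : X × F → F := fun z =>
    fderiv ℝ (fun y => B y (μ y)) z.1 (f z) - (fderiv ℝ B z.1 (f z)) z.2
  have hfst : MapsTo (Prod.fst : X × F → X) (Ω ×ˢ univ) Ω := fun z hz => hz.1
  have sf1 : ContDiffOn ℝ 1 f (Ω ×ˢ univ) := sf.of_le (by norm_num)
  have sΓ : ContDiffOn ℝ 1 Γ (Ω ×ˢ univ) := by
    refine ContDiffOn.sub (ContDiffOn.clm_apply ?_ sf1)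
      (ContDiffOn.clm_apply (ContDiffOn.clm_apply ?_ sf1) contDiffOn_snd)
    · exact (sc.fderiv_of_isOpen hΩ (by norm_num)).comp contDiffOn_fst hfst
    · exact (sB.fderiv_of_isOpen hΩ (by norm_num)).comp contDiffOn_fst hfst
  have hK₀ : IsCompact (Z '' Icc 0 T) := isCompact_Icc.image_of_continuousOn
    fun t ht => (hZ t ht).1.continuousAt.continuousWithinAt
  have hK₀Ω : Z '' Icc 0 T ⊆ Ω := by
    rintro _ ⟨t, ht, rfl⟩; exact (hZ t ht).2
  obtain ⟨δ, hδ, hδΩ⟩ := hK₀.exists_cthickening_subset_open hΩ hK₀Ω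
  set K := Metric.cthickening δ (Z '' Icc 0 T) with hKdef
  have hK : IsCompact K := hK₀.cthickening
  set K' := Metric.cthickening (δ / 2) (Z '' Icc 0 T) with hK'def
  obtain ⟨R₀, hR₀⟩ := hK.exists_bound_of_continuousOn (sμ.continuousOn.mono hδΩ)
  set R := |R₀| + 1 with hR
  have hΩ' : IsOpen (Ω ×ˢ (univ : Set F)) := hΩ.prod isOpen_univ
  have hKR : IsCompact (K ×ˢ Metric.closedBall (0:F) R) := hK.prod (isCompact_closedBall _ _)
  have hKRΩ : K ×ˢ Metric.closedBall (0:F) R ⊆ Ω ×ˢ univ := prod_mono hδΩ (subset_univ _)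
  obtain ⟨L, hL1, hLR, ⟨f1, f2⟩, ⟨B1, B2⟩, ⟨Bi1, Bi2⟩, ⟨c1, c2⟩, ⟨m1, m2⟩, ⟨G1, G2⟩,
      ⟨k1, k2⟩, P1, P2⟩ :=
    ((Filter.eventually_ge_atTop (1:ℝ)).and <| (Filter.eventually_ge_atTop R).and <|
      (lipK hΩ' hKR hKRΩ sf1).and <|
      (lipK hΩ hK hδΩ (sB.of_le (by norm_num))).and <|
      (lipK hΩ hK hδΩ (sBi.of_le (by norm_num))).and <|
      (lipK hΩ hK hδΩ (sc.of_le (by norm_num))).and <|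
      (lipK hΩ hK hδΩ (sμ.of_le (by norm_num))).and <|
      (lipK hΩ' hKR hKRΩ sΓ).and <|
      (lipK hΩ hK hδΩ sk).and <| (lipK hΩ hK hδΩ sΦ)).exists
  have hL0 : 0 ≤ L := zero_le_one.trans hL1
  have H : Bd f g w B Bi μ Γ K' K L R (δ / 2) :=
    { L1 := hL1
      R1 := by rw [hR]; linarith [abs_nonneg R₀]
      RL := hLR
      ρ0 := by positivity
      KK := fun x hx y hy => by
        rw [Metric.mem_closedBall] at hy
        have h1 : y ∈ Metric.cthickening (δ / 2) K' :=
          Metric.mem_cthickening_of_dist_le y x _ _ hx hy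
        have h2 := Metric.cthickening_cthickening_subset (by positivity : 0 ≤ δ / 2)
          (by positivity : 0 ≤ δ / 2) (Z '' Icc 0 T) h1
        rwa [add_halves] at h2
      fB := fun x hx l hl => f1 (x, l) ⟨hx, by simpa using hl⟩
      fL := prodLip hL0 f2
      gD := fun x hx => gD x (hδΩ hx)
      wD := fun x hx => wD x (hδΩ hx)
      bD := fun x hx l => by
        have hn := hΩ.mem_nhds (hδΩ hx)
        have d1 := ((sc.contDiffAt hn).differentiableAt (by norm_num)).hasFDerivAt
        have d2 := ((sB.contDiffAt hn).differentiableAt (by norm_num)).hasFDerivAt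
        have d3 := d1.sub (d2.clm_apply (hasFDerivAt_const l x))
        refine ⟨_, d3.congr_of_eventuallyEq (Filter.Eventually.of_forall fun y => ?_), ?_⟩
        · simp
        · simp [Γ]
      BB := B1
      BiB := Bi1
      BBi := fun x hx => BBi x (hδΩ hx)
      BiBe := fun x hx => BiBe x (hδΩ hx)
      BL := B2
      cL := c2
      μL := m2
      μB := fun x hx => by
        rw [hR, add_sub_cancel_right]; exact (hR₀ x hx).trans (le_abs_self _)
      ΓB := fun x hx l hl => G1 (x, l) ⟨hx, by simpa using hl⟩
      ΓL := prodLip hL0 G2 }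
  obtain ⟨h₀, hh₀, C, hC, hmain⟩ := H.main (Pi := Pi) (Φ := Φ)
    (fun x hx => by
      rw [hk x (hδΩ hx)]
      exact ((k x).le_opNorm _).trans (by gcongr; exact k1 x hx))
    (fun x hx => hPD x (hδΩ hx)) P2 hT
    (fun t ht => ⟨(hZ t ht).1, fun y hy => by
      rw [Metric.mem_closedBall] at hy
      exact Metric.mem_cthickening_of_dist_le y (Z t) _ _ ⟨t, ht, rfl⟩ hy⟩) hg0 hw0
  refine ⟨h₀, hh₀, C, hC, fun N hN hNh => ?_⟩
  obtain ⟨xa, lam, x, a0, a1, a2⟩ := hmain N hN hNh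
  refine ⟨xa, lam, x, a0, fun n hn => ?_, a2⟩
  obtain ⟨b1, b2, b3, b4⟩ := a1 n hn
  exact ⟨b1, fun t ht => ⟨(b2 t ht).1, hδΩ (b2 t ht).2⟩, b3, b4⟩

end abstractPart5

section abstractPart6

variable {E F : Type*} [NormedAddCommGroup E] [NormedSpace ℝ E] [FiniteDimensional ℝ E]
  [NormedAddCommGroup F] [NormedSpace ℝ F] [FiniteDimensional ℝ F]

theorem semiMain {g : E → F} (sg : ContDiff ℝ 4 g) (A : E →L[ℝ] E) {a : E → E}
    (sa : ContDiff ℝ 2 a) {J : E → F →L[ℝ] E} (sJ : ContDiff ℝ 2 J)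
    {μ : E × E → F}
    (hμ : ∀ x : E × E, IsUnit (fderiv ℝ g x.1 ∘L A ∘L J x.1) →
      (fderiv ℝ g x.1 ∘L A ∘L J x.1) (μ x) =
        fderiv ℝ (fderiv ℝ g) x.1 (A x.2) (A x.2) + fderiv ℝ g x.1 (A (a x.1)))
    {Z : ℝ → E × E} {T : ℝ} (hT : 0 < T)
    (hZ : ∀ t ∈ Icc (0:ℝ) T,
      HasDerivAt Z (A (Z t).2, a (Z t).1 - J (Z t).1 (μ (Z t))) t ∧
      IsUnit (fderiv ℝ g (Z t).1 ∘L A ∘L J (Z t).1))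
    (hg0 : g (Z 0).1 = 0) (hw0 : fderiv ℝ g (Z 0).1 (A (Z 0).2) = 0) :
    ∃ h₀ > 0, ∃ C > 0, ∀ N : ℕ, 0 < N → T / (N : ℝ) ≤ h₀ →
      ∃ (xa : ℕ → E × E) (lam : ℕ → F) (x : ℕ → ℝ → E × E), xa 0 = Z 0 ∧
      (∀ n < N, x n 0 = xa n ∧
        (∀ t ∈ Icc (0:ℝ) (T / (N : ℝ)),
          HasDerivAt (x n) (A (x n t).2, a (x n t).1 - J (x n t).1 (lam n)) t) ∧
        xa (n + 1) = x n (T / (N : ℝ)) ∧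
        ‖lam n - μ (Z ((n : ℝ) * (T / (N : ℝ))))‖ ≤ C * (T / (N : ℝ))) ∧
      (∀ n ≤ N, g (xa n).1 = 0 ∧
        ‖xa n - Z ((n : ℝ) * (T / (N : ℝ)))‖ ≤ C * (T / (N : ℝ)) ^ 2 ∧
        ‖fderiv ℝ g (xa n).1 (A (xa n).2)‖ ≤ C * (T / (N : ℝ)) ^ 2) := by
  have : CompleteSpace F := FiniteDimensional.complete ℝ F
  let f : (E × E) × F → E × E := fun z => (A z.1.2, a z.1.1 - J z.1.1 z.2)
  let w : E × E → F := fun x => fderiv ℝ g x.1 (A x.2)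
  let B : E × E → F →L[ℝ] F := fun x => fderiv ℝ g x.1 ∘L A ∘L J x.1
  let Bi : E × E → F →L[ℝ] F := fun x => Ring.inverse (B x)
  let b : E × E → F := fun x =>
    fderiv ℝ (fderiv ℝ g) x.1 (A x.2) (A x.2) + fderiv ℝ g x.1 (A (a x.1))
  let k : E × E → F →L[ℝ] E × E := fun x => ContinuousLinearMap.inr ℝ E E ∘L J x.1 ∘L Bi x
  let Pi : E × E → E × E := fun x => x - k x (w x)
  let Φ : E × E → E × E := fun x => fderiv ℝ Pi x (f (x, 0))
  let Ω : Set (E × E) := {x | IsUnit (B x)}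
  have s1 : ContDiff ℝ 3 (fderiv ℝ g) := sg.fderiv_right (by norm_num)
  have s2 : ContDiff ℝ 2 (fderiv ℝ (fderiv ℝ g)) := s1.fderiv_right (by norm_num)
  have s1' : ContDiff ℝ 2 (fun x : E × E => fderiv ℝ g x.1) :=
    (s1.of_le (by norm_num)).comp contDiff_fst
  have s2' : ContDiff ℝ 2 (fun x : E × E => fderiv ℝ (fderiv ℝ g) x.1) := s2.comp contDiff_fst
  have sJ' : ContDiff ℝ 2 (fun x : E × E => J x.1) := sJ.comp contDiff_fst
  have sA' : ContDiff ℝ 2 (fun x : E × E => A x.2) := A.contDiff.comp contDiff_snd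
  have sB : ContDiff ℝ 2 B := s1'.clm_comp (contDiff_const.clm_comp sJ')
  have sw : ContDiff ℝ 2 w := s1'.clm_apply sA'
  have sb : ContDiff ℝ 2 b := ((s2'.clm_apply sA').clm_apply sA').add
    (s1'.clm_apply (A.contDiff.comp (sa.comp contDiff_fst)))
  have hΩ : IsOpen Ω := Units.isOpen.preimage sB.continuous
  have sBi : ContDiffOn ℝ 2 Bi Ω := by
    intro x hx
    obtain ⟨u, hu⟩ : IsUnit (B x) := hx
    have h1 := contDiffAt_ringInverse ℝ (n := 2) u
    rw [hu] at h1
    exact (h1.comp x sB.contDiffAt).contDiffWithinAt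
  have BBi : ∀ x ∈ Ω, ∀ η, B x (Bi x η) = η := fun x hx η => by
    have := Ring.mul_inverse_cancel (B x) hx
    exact congrArg (fun (M : F →L[ℝ] F) => M η) this
  have BiBe : ∀ x ∈ Ω, ∀ η, Bi x (B x η) = η := fun x hx η => by
    have := Ring.inverse_mul_cancel (B x) hx
    exact congrArg (fun (M : F →L[ℝ] F) => M η) this
  have sμ : ContDiffOn ℝ 2 μ Ω := by
    refine (sBi.clm_apply sb.contDiffOn).congr fun x hx => ?_
    have h1 : B x (μ x) = b x := hμ x hx
    rw [← h1, BiBe x hx]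
  have sk : ContDiffOn ℝ 2 k Ω :=
    contDiffOn_const.clm_comp (sJ'.contDiffOn.clm_comp sBi)
  have sPi : ContDiffOn ℝ 2 Pi Ω := contDiffOn_id.sub (sk.clm_apply sw.contDiffOn)
  have sf : ContDiff ℝ 2 f := by
    refine ContDiff.prodMk (sA'.comp contDiff_fst) ?_
    exact (sa.comp (contDiff_fst.comp contDiff_fst)).sub
      ((sJ'.comp contDiff_fst).clm_apply contDiff_snd)
  have sΦ : ContDiffOn ℝ 1 Φ Ω := by
    refine (sPi.fderiv_of_isOpen hΩ (by norm_num)).clm_apply ?_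
    exact ((sf.of_le (by norm_num)).comp (contDiff_id.prodMk contDiff_const)).contDiffOn
  have gD : ∀ x ∈ Ω, ∀ l : F, ∃ g' : E × E →L[ℝ] F, HasFDerivAt (fun x : E × E => g x.1) g' x ∧
      g' (f (x, l)) = w x := by
    intro x _ l
    have h1 : HasFDerivAt g (fderiv ℝ g x.1) x.1 :=
      (sg.differentiable (by norm_num) x.1).hasFDerivAt
    exact ⟨_, h1.comp x hasFDerivAt_fst, by simp [f, w]⟩
  have wD : ∀ x ∈ Ω, ∀ l : F, ∃ w' : E × E →L[ℝ] F, HasFDerivAt w w' x ∧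
      w' (f (x, l)) = B x (μ x - l) := by
    intro x hx l
    have h1 : HasFDerivAt (fderiv ℝ g) (fderiv ℝ (fderiv ℝ g) x.1) x.1 :=
      (s1.differentiable (by norm_num) x.1).hasFDerivAt
    have h2 : HasFDerivAt (fun x : E × E => A x.2) _ x :=
      A.hasFDerivAt.comp x hasFDerivAt_snd
    have h3 : HasFDerivAt (fun x : E × E => fderiv ℝ g x.1) _ x := h1.comp x hasFDerivAt_fst
    refine ⟨_, h3.clm_apply h2, ?_⟩
    have h4 : B x (μ x) = b x := hμ x hx
    rw [map_sub, h4]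
    simp [f, B, b]
    abel
  have hPD : ∀ x ∈ Ω, ∀ l : F, ∃ P' : E × E →L[ℝ] E × E, HasFDerivAt Pi P' x ∧
      P' (f (x, l)) = Φ x := by
    intro x hx l
    have h1 : HasFDerivAt Pi (fderiv ℝ Pi x) x :=
      ((sPi.contDiffAt (hΩ.mem_nhds hx)).differentiableAt (by norm_num)).hasFDerivAt
    refine ⟨_, h1, ?_⟩
    have e : f (x, l) = f (x, 0) - (0, J x.1 l) := by simp [f]
    have h2 : HasDerivAt (fun s : ℝ => x + s • ((0 : E), J x.1 l)) ((0 : E), J x.1 l) 0 := by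
      simpa using ((hasDerivAt_id (0:ℝ)).smul_const ((0 : E), J x.1 l)).const_add x
    have h3 : HasDerivAt (fun s : ℝ => Pi (x + s • ((0 : E), J x.1 l)))
        (fderiv ℝ Pi x ((0 : E), J x.1 l)) 0 := by
      have h1' : HasFDerivAt Pi (fderiv ℝ Pi x) (x + (0:ℝ) • ((0 : E), J x.1 l)) := by
        rw [zero_smul, add_zero]; exact h1
      exact h1'.comp_hasDerivAt (0:ℝ) h2
    have h4 : (fun s : ℝ => Pi (x + s • ((0 : E), J x.1 l))) = fun _ => Pi x := by
      funext s
      have e1 : (x + s • ((0 : E), J x.1 l)).1 = x.1 := by simp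
      have e2 : B (x + s • ((0 : E), J x.1 l)) = B x := by simp only [B, e1]
      have e3 : k (x + s • ((0 : E), J x.1 l)) = k x := by simp only [k, Bi, e1, e2]
      have e4 : w (x + s • ((0 : E), J x.1 l)) = w x + s • B x l := by
        simp [w, B]
      have e5 : k x (B x l) = (0, J x.1 l) := by
        simp only [k, ContinuousLinearMap.comp_apply, BiBe x hx]
        simp
      simp only [Pi, e3, e4, map_add, map_smul, e5]
      abel
    rw [h4] at h3
    have h5 := h3.unique (hasDerivAt_const (0:ℝ) (Pi x))
    rw [e, map_sub, h5, sub_zero]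
  have hw : ∀ t ∈ Icc (0:ℝ) T, w (Z t) = 0 := by
    intro t ht
    have h1 := mvt0 (h := T) (ε := 0) (D := fun t => w (Z t)) (D' := fun _ => 0)
      (fun s hs => by
        obtain ⟨w', h1, h2⟩ := wD (Z s) (hZ s hs).2 (μ (Z s))
        rw [sub_self, map_zero] at h2
        rw [← h2]
        exact h1.comp_hasDerivAt s (hZ s hs).1) (fun s _ => by simp) t ht
    have h2 : w (Z 0) = 0 := hw0
    rw [h2, sub_zero, zero_mul] at h1
    exact norm_le_zero_iff.1 h1
  have hZ' : ∀ t ∈ Icc (0:ℝ) T, HasDerivAt Z (Φ (Z t)) t ∧ Z t ∈ Ω := by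
    intro t ht
    refine ⟨?_, (hZ t ht).2⟩
    obtain ⟨P', h1, h2⟩ := hPD (Z t) (hZ t ht).2 (μ (Z t))
    have h3 : HasDerivAt (fun s => Pi (Z s)) (Φ (Z t)) t := by
      rw [← h2]; exact h1.comp_hasDerivAt t (hZ t ht).1
    have hfix : ∀ s ∈ Icc (0:ℝ) T, Z s = Pi (Z s) := fun s hs => by
      simp only [Pi, hw s hs, map_zero, sub_zero]
    have h4 : HasDerivWithinAt Z (Φ (Z t)) (Icc 0 T) t :=
      h3.hasDerivWithinAt.congr hfix (hfix t ht)
    have h5 := (uniqueDiffOn_Icc hT t ht).eq_deriv _ (hZ t ht).1.hasDerivWithinAt h4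
    rw [← h5]; exact (hZ t ht).1
  obtain ⟨h₀, hh₀, C, hC, hmain⟩ := smoothMain (f := f) (g := fun x => g x.1) (w := w) (B := B)
    (Bi := Bi) (μ := μ) (k := k) (Pi := Pi) (Φ := Φ) hΩ sf.contDiffOn sB.contDiffOn sBi sμ
    (sk.of_le (by norm_num)) sΦ (fun x _ => by simp [Pi]) gD wD BBi BiBe hPD hT hZ' hg0 hw0
  refine ⟨h₀, hh₀, C, hC, fun N hN hNh => ?_⟩
  obtain ⟨xa, lam, x, a0, a1, a2⟩ := hmain N hN hNh
  refine ⟨xa, lam, x, a0, fun n hn => ?_, a2⟩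
  obtain ⟨b1, b2, b3, b4⟩ := a1 n hn
  exact ⟨b1, fun t ht => (b2 t ht).1, b3, b4⟩

end abstractPart6

section concretePart

variable {m ν : ℕ}

/-- The continuous linear map of a matrix. -/
noncomputable def matCL {a b : ℕ} (N : Matrix (Fin a) (Fin b) ℝ) :
    (Fin b → ℝ) →L[ℝ] (Fin a → ℝ) :=
  LinearMap.toContinuousLinearMap N.mulVecLin

theorem matCL_apply {a b : ℕ} (N : Matrix (Fin a) (Fin b) ℝ) (v : Fin b → ℝ) :
    matCL N v = N *ᵥ v := rfl

theorem matCL_isUnit {a : ℕ} (N : Matrix (Fin a) (Fin a) ℝ) : IsUnit (matCL N) ↔ IsUnit N := by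
  constructor
  · rintro ⟨u, hu⟩
    rw [← Matrix.mulVec_injective_iff_isUnit]
    intro v w hvw
    have h1 : (u : (Fin a → ℝ) →L[ℝ] (Fin a → ℝ)) v = (u : (Fin a → ℝ) →L[ℝ] (Fin a → ℝ)) w := by
      rw [hu]; exact hvw
    have h2 : ∀ z, (↑u⁻¹ : (Fin a → ℝ) →L[ℝ] (Fin a → ℝ))
        ((u : (Fin a → ℝ) →L[ℝ] (Fin a → ℝ)) z) = z := fun z =>
      congrArg (fun (L : (Fin a → ℝ) →L[ℝ] (Fin a → ℝ)) => L z) u.inv_mul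
    rw [← h2 v, h1, h2]
  · intro h
    have hd : IsUnit N.det := (Matrix.isUnit_iff_isUnit_det N).1 h
    refine ⟨⟨matCL N, matCL N⁻¹, ?_, ?_⟩, rfl⟩
    · ext1 v
      change N *ᵥ (N⁻¹ *ᵥ v) = v
      rw [Matrix.mulVec_mulVec, Matrix.mul_nonsing_inv _ hd, Matrix.one_mulVec]
    · ext1 v
      change N⁻¹ *ᵥ (N *ᵥ v) = v
      rw [Matrix.mulVec_mulVec, Matrix.nonsing_inv_mul _ hd, Matrix.one_mulVec]

theorem clm_sum (φ : (Fin m → ℝ) →L[ℝ] ℝ) (v : Fin m → ℝ) :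
    φ v = ∑ i, v i * φ (Pi.single i 1) := by
  have h := LinearMap.pi_apply_eq_sum_univ (φ : (Fin m → ℝ) →ₗ[ℝ] ℝ) v
  simp only [smul_eq_mul, ContinuousLinearMap.coe_coe] at h
  rw [h]
  refine Finset.sum_congr rfl fun i _ => ?_
  congr 2
  funext j
  simp [Pi.single_apply, eq_comm]

theorem grad_dot (U : (Fin m → ℝ) → ℝ) (q v : Fin m → ℝ) :
    grad U q ⬝ᵥ v = fderiv ℝ U q v := by
  rw [clm_sum]
  simp only [dotProduct, grad]
  exact Finset.sum_congr rfl fun i _ => mul_comm _ _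

theorem fderiv_comp_apply {g : (Fin m → ℝ) → (Fin ν → ℝ)} {q : Fin m → ℝ}
    (hg : DifferentiableAt ℝ g q) (c : Fin ν) (v : Fin m → ℝ) :
    fderiv ℝ (fun x => g x c) q v = fderiv ℝ g q v c := by
  have h := (hasFDerivAt_pi'.1 hg.hasFDerivAt) c
  rw [h.fderiv]; rfl

theorem gradMat_T {g : (Fin m → ℝ) → (Fin ν → ℝ)} {q : Fin m → ℝ}
    (hg : DifferentiableAt ℝ g q) (v : Fin m → ℝ) :
    (gradMat g q)ᵀ *ᵥ v = fderiv ℝ g q v := by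
  funext c
  rw [← fderiv_comp_apply hg, clm_sum]
  simp only [Matrix.mulVec, dotProduct, gradMat, Matrix.transpose_apply, Matrix.of_apply]
  exact Finset.sum_congr rfl fun i _ => mul_comm _ _

theorem hessVec_eq {g : (Fin m → ℝ) → (Fin ν → ℝ)} (hg : ContDiff ℝ 4 g) (q v w : Fin m → ℝ) :
    hessVec g q v w = fderiv ℝ (fderiv ℝ g) q v w := by
  funext c
  have h0 : Differentiable ℝ g := hg.differentiable (by norm_num)
  have h1 : ContDiff ℝ 3 (fderiv ℝ g) := hg.fderiv_right (by norm_num)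
  have h2 : DifferentiableAt ℝ (fderiv ℝ g) q := h1.differentiable (by norm_num) q
  unfold hessVec
  have e : (fun x => fderiv ℝ (fun y => g y c) x w) = fun x => (fun x => fderiv ℝ g x w) x c := by
    funext x; exact fderiv_comp_apply (h0 x) c w
  have h3 := h2.hasFDerivAt.clm_apply (hasFDerivAt_const w q)
  rw [e, fderiv_comp_apply h3.differentiableAt, h3.fderiv]
  simp

theorem hasDerivAt_dot {x y : ℝ → Fin m → ℝ} {x' y' : Fin m → ℝ} {t : ℝ}
    (hx : HasDerivAt x x' t) (hy : HasDerivAt y y' t) :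
    HasDerivAt (fun s => x s ⬝ᵥ y s) (x' ⬝ᵥ y t + x t ⬝ᵥ y') t := by
  simp only [dotProduct, ← Finset.sum_add_distrib]
  exact HasDerivAt.fun_sum fun i _ => (hasDerivAt_pi.1 hx i).mul (hasDerivAt_pi.1 hy i)

theorem energyStep {M : Matrix (Fin m) (Fin m) ℝ} (hM : M.PosDef)
    {U : (Fin m → ℝ) → ℝ} (hU : Differentiable ℝ U)
    {g : (Fin m → ℝ) → (Fin ν → ℝ)} (hg : Differentiable ℝ g) {u v : ℝ → Fin m → ℝ}
    {l : Fin ν → ℝ} {h : ℝ} (hh : 0 ≤ h)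
    (hu : ∀ t ∈ Icc (0:ℝ) h, HasDerivAt u (M⁻¹ *ᵥ v t) t)
    (hv : ∀ t ∈ Icc (0:ℝ) h, HasDerivAt v (-(grad U (u t) + gradMat g (u t) *ᵥ l)) t)
    (g0 : g (u 0) = 0) (g1 : g (u h) = 0) : Ham M U (u h) (v h) = Ham M U (u 0) (v 0) := by
  have hs : (M⁻¹)ᵀ = M⁻¹ := by
    have := hM.isHermitian.inv
    rwa [Matrix.IsHermitian, Matrix.conjTranspose_eq_transpose_of_trivial] at this
  have key := mvt0 (h := h) (ε := 0) (D := fun t => Ham M U (u t) (v t) + l ⬝ᵥ g (u t))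
    (D' := fun _ => (0:ℝ)) (fun t ht => by
      have d1 : HasDerivAt (fun s => M⁻¹ *ᵥ v s)
          (M⁻¹ *ᵥ (-(grad U (u t) + gradMat g (u t) *ᵥ l))) t :=
        (matCL M⁻¹).hasFDerivAt.comp_hasDerivAt t (hv t ht)
      have d2 := (hasDerivAt_dot (hv t ht) d1).const_mul (1 / 2 : ℝ)
      have d3 : HasDerivAt (fun s => U (u s)) (fderiv ℝ U (u t) (M⁻¹ *ᵥ v t)) t :=
        (hU (u t)).hasFDerivAt.comp_hasDerivAt t (hu t ht)
      have d4 : HasDerivAt (fun s => g (u s)) (fderiv ℝ g (u t) (M⁻¹ *ᵥ v t)) t :=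
        (hg (u t)).hasFDerivAt.comp_hasDerivAt t (hu t ht)
      have d5 := hasDerivAt_dot (hasDerivAt_const t l) d4
      refine ((d2.add d3).add d5).congr_deriv ?_
      have e1 : v t ⬝ᵥ (M⁻¹ *ᵥ (-(grad U (u t) + gradMat g (u t) *ᵥ l)))
          = (-(grad U (u t) + gradMat g (u t) *ᵥ l)) ⬝ᵥ (M⁻¹ *ᵥ v t) := by
        rw [Matrix.dotProduct_mulVec, ← Matrix.mulVec_transpose, hs, dotProduct_comm]
      rw [e1, ← grad_dot, ← gradMat_T (hg (u t))]
      have e2 : l ⬝ᵥ ((gradMat g (u t))ᵀ *ᵥ (M⁻¹ *ᵥ v t))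
          = (gradMat g (u t) *ᵥ l) ⬝ᵥ (M⁻¹ *ᵥ v t) := by
        rw [Matrix.dotProduct_mulVec, Matrix.vecMul_transpose]
      rw [e2]
      simp only [neg_dotProduct, add_dotProduct, zero_dotProduct]
      ring) (fun t _ => by simp) h ⟨hh, le_rfl⟩
  rw [zero_mul] at key
  have := norm_le_zero_iff.1 key
  simp only [g0, g1, dotProduct_zero, add_zero] at this
  exact sub_eq_zero.1 this

end concretePart

theorem stmt10 {m ν : ℕ} (hmn : ν < m)
    (M : Matrix (Fin m) (Fin m) ℝ) (hM : M.PosDef)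
    (U : (Fin m → ℝ) → ℝ) (hU : ∀ x, AnalyticAt ℝ U x)
    (g : (Fin m → ℝ) → (Fin ν → ℝ)) (hg : ∀ x, AnalyticAt ℝ g x)
    (T : ℝ) (hT : 0 < T)
    (q p : ℝ → Fin m → ℝ)
    (hq : ∀ t ∈ Set.Icc (0:ℝ) T, HasDerivAt q (M⁻¹ *ᵥ p t) t)
    (hp : ∀ t ∈ Set.Icc (0:ℝ) T,
      HasDerivAt p (-(grad U (q t) + gradMat g (q t) *ᵥ lagMult M U g (q t) (p t))) t)
    (hcon : ∀ t ∈ Set.Icc (0:ℝ) T, g (q t) = 0)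
    (hg0 : g (q 0) = 0)
    (hh0 : (gradMat g (q 0))ᵀ *ᵥ (M⁻¹ *ᵥ p 0) = 0)
    (hns : ∀ t ∈ Set.Icc (0:ℝ) T,
      IsUnit ((gradMat g (q t))ᵀ * M⁻¹ * gradMat g (q t))) :
    ∃ h₀ > 0, ∃ C > 0, ∀ N : ℕ, 0 < N → T / (N : ℝ) ≤ h₀ →
      ∃ (qa pa : ℕ → Fin m → ℝ) (lam : ℕ → Fin ν → ℝ) (u v : ℕ → ℝ → Fin m → ℝ),
        qa 0 = q 0 ∧ pa 0 = p 0 ∧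
        (∀ n < N,
          u n 0 = qa n ∧ v n 0 = pa n ∧
          (∀ t ∈ Set.Icc (0:ℝ) (T / (N : ℝ)),
            HasDerivAt (u n) (M⁻¹ *ᵥ v n t) t ∧
            HasDerivAt (v n) (-(grad U (u n t) + gradMat g (u n t) *ᵥ lam n)) t) ∧
          qa (n + 1) = u n (T / (N : ℝ)) ∧ pa (n + 1) = v n (T / (N : ℝ)) ∧
          ‖lam n - lagMult M U g (q ((n : ℝ) * (T / (N : ℝ)))) (p ((n : ℝ) * (T / (N : ℝ))))‖ ≤
            C * (T / (N : ℝ))) ∧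
        (∀ n ≤ N,
          g (qa n) = 0 ∧
          Ham M U (qa n) (pa n) = Ham M U (qa 0) (pa 0) ∧
          ‖qa n - q ((n : ℝ) * (T / (N : ℝ)))‖ ≤ C * (T / (N : ℝ)) ^ 2 ∧
          ‖pa n - p ((n : ℝ) * (T / (N : ℝ)))‖ ≤ C * (T / (N : ℝ)) ^ 2 ∧
          ‖(gradMat g (qa n))ᵀ *ᵥ (M⁻¹ *ᵥ pa n)‖ ≤ C * (T / (N : ℝ)) ^ 2) := by
  have sg : ContDiff ℝ 4 g := contDiff_iff_contDiffAt.2 fun x => (hg x).contDiffAt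
  have sU : ContDiff ℝ 4 U := contDiff_iff_contDiffAt.2 fun x => (hU x).contDiffAt
  have dg : Differentiable ℝ g := sg.differentiable (by norm_num)
  have dU : Differentiable ℝ U := sU.differentiable (by norm_num)
  have s1 : ContDiff ℝ 2 (fderiv ℝ g) := sg.fderiv_right (by norm_num)
  have sa : ContDiff ℝ 2 (fun x => -grad U x) := by
    refine ContDiff.neg (contDiff_pi.2 fun i => ?_)
    exact (sU.fderiv_right (by norm_num)).clm_apply contDiff_const
  have sJ : ContDiff ℝ 2 (fun x => matCL (gradMat g x)) := by
    refine contDiff_clm_apply_iff.2 fun l => contDiff_pi.2 fun i => ?_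
    simp only [matCL_apply, Matrix.mulVec, dotProduct, gradMat, Matrix.of_apply]
    refine ContDiff.sum fun c _ => ContDiff.mul ?_ contDiff_const
    have sc : ContDiff ℝ 4 (fun x => g x c) := contDiff_pi.1 sg c
    exact (sc.fderiv_right (by norm_num)).clm_apply contDiff_const
  have hB : ∀ x, fderiv ℝ g x ∘L matCL M⁻¹ ∘L matCL (gradMat g x)
      = matCL ((gradMat g x)ᵀ * M⁻¹ * gradMat g x) := by
    intro x
    ext1 v
    simp only [ContinuousLinearMap.comp_apply, matCL_apply, ← gradMat_T (dg x),
      Matrix.mulVec_mulVec, Matrix.mul_assoc]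
  obtain ⟨h₀, hh₀, C, hC, hmain⟩ := semiMain sg (matCL M⁻¹) sa sJ
    (μ := fun x => lagMult M U g x.1 x.2)
    (fun x hx => by
      rw [hB, matCL_isUnit] at hx
      have hd := (Matrix.isUnit_iff_isUnit_det _).1 hx
      rw [hB, matCL_apply, lagMult, Matrix.mulVec_mulVec, Matrix.mul_nonsing_inv _ hd,
        Matrix.one_mulVec, hessVec_eq sg, gradMat_T (dg _)]
      simp only [matCL_apply, map_neg, Matrix.mulVec_neg, sub_eq_add_neg])
    (Z := fun t => (q t, p t)) hT
    (fun t ht => ⟨by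
      refine ((hq t ht).prodMk (hp t ht)).congr_deriv ?_
      simp only [matCL_apply, neg_add, sub_eq_add_neg], by
      rw [hB, matCL_isUnit]; exact hns t ht⟩) hg0
    (by rw [matCL_apply, ← gradMat_T (dg _)]; exact hh0)
  refine ⟨h₀, hh₀, C, hC, fun N hN hNh => ?_⟩
  obtain ⟨xa, lam, x, a0, a1, a2⟩ := hmain N hN hNh
  have hNpos : (0:ℝ) < N := by exact_mod_cast hN
  have hpos : 0 ≤ T / (N : ℝ) := by positivity
  have hu : ∀ n < N, ∀ t ∈ Set.Icc (0:ℝ) (T / (N : ℝ)),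
      HasDerivAt (fun s => (x n s).1) (M⁻¹ *ᵥ (x n t).2) t ∧
      HasDerivAt (fun s => (x n s).2)
        (-(grad U (x n t).1 + gradMat g (x n t).1 *ᵥ lam n)) t := by
    intro n hn t ht
    have h1 := (a1 n hn).2.1 t ht
    refine ⟨?_, ?_⟩
    · exact hasFDerivAt_fst.comp_hasDerivAt t h1
    · refine HasDerivAt.congr_deriv (hasFDerivAt_snd.comp_hasDerivAt t h1) ?_
      change -grad U (x n t).1 - gradMat g (x n t).1 *ᵥ lam n = _
      rw [neg_add, sub_eq_add_neg]
  have hE : ∀ n ≤ N, Ham M U (xa n).1 (xa n).2 = Ham M U (xa 0).1 (xa 0).2 := by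
    intro n
    induction n with
    | zero => intro _; rfl
    | succ n ih =>
      intro hn
      obtain ⟨b1, b2, b3, b4⟩ := a1 n hn
      rw [← ih (by omega), b3, ← b1]
      refine energyStep hM dU dg (u := fun s => (x n s).1) (v := fun s => (x n s).2)
        (l := lam n) hpos (fun t ht => (hu n hn t ht).1) (fun t ht => (hu n hn t ht).2) ?_ ?_
      · change g (x n 0).1 = 0
        rw [b1]; exact (a2 n (by omega)).1
      · change g (x n (T / (N : ℝ))).1 = 0
        rw [← b3]; exact (a2 (n + 1) hn).1
  refine ⟨fun n => (xa n).1, fun n => (xa n).2, lam, fun n s => (x n s).1, fun n s => (x n s).2,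
    congrArg Prod.fst a0, congrArg Prod.snd a0, fun n hn => ?_, fun n hn => ?_⟩
  · obtain ⟨b1, b2, b3, b4⟩ := a1 n hn
    exact ⟨congrArg Prod.fst b1, congrArg Prod.snd b1, hu n hn, congrArg Prod.fst b3,
      congrArg Prod.snd b3, b4⟩
  · obtain ⟨c1, c2, c3⟩ := a2 n hn
    refine ⟨c1, hE n hn, (norm_fst_le _).trans c2, (norm_snd_le _).trans c2, ?_⟩
    rw [gradMat_T (dg _)]
    exact c3
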